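/- arXiv:2005.08779 — 4 statements merged into one kernel-verified Lean document; each statement's English description precedes it below -/
import Mathlib

section
/- The transpose Tr provides a bijection between the isomorphism classes of reduced semi-Gorenstein-projective left A-modules M whose A-dual M* is projective, and the isomorphism classes of reduced ∞-torsionfree right A-modules Z of projective dimension at most 2. -/
/-!
Common background: `A` is an artin algebra (an algebra over a commutative artinian
ring `k`, finitely generated as `k`-module).  Left `A`-modules are `Module A M`;
right `A`-modules are `Module Aᵐᵒᵖ N`.  `Dl A M = Hom_A(M,A)` is the `A`-dual of a
left module (a right module) and `Dr A N` the dual of a right module (a left module);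
`evalL A M : M → M**` is the canonical evaluation map `φ_M`.
-/

open CategoryTheory LinearMap

universe u

section Preliminaries

variable (A : Type u) [Ring A]

/-- The `A`-dual of a left `A`-module: `M* = Hom_A(M, A)`, a right `A`-module. -/
abbrev Dl (M : Type u) [AddCommGroup M] [Module A M] : Type u := M →ₗ[A] A

/-- The `A`-dual of a right `A`-module: a left `A`-module. -/
abbrev Dr (N : Type u) [AddCommGroup N] [Module Aᵐᵒᵖ N] : Type u := N →ₗ[Aᵐᵒᵖ] A

variable {A}

/-- The dual of a map of left modules. -/
def dualMapL {M N : Type u} [AddCommGroup M] [Module A M] [AddCommGroup N] [Module A N]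
    (g : M →ₗ[A] N) : Dl A N →ₗ[Aᵐᵒᵖ] Dl A M where
  toFun h := h.comp g
  map_add' h₁ h₂ := by ext; simp
  map_smul' a h := by ext; simp

/-- The dual of a map of right modules. -/
def dualMapR {M N : Type u} [AddCommGroup M] [Module Aᵐᵒᵖ M] [AddCommGroup N] [Module Aᵐᵒᵖ N]
    (g : M →ₗ[Aᵐᵒᵖ] N) : Dr A N →ₗ[A] Dr A M where
  toFun h := h.comp g
  map_add' h₁ h₂ := by ext; simp
  map_smul' a h := by ext; simp

variable (A)

/-- The canonical evaluation map `φ_M : M → M**` for a left module `M`. -/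
def evalL (M : Type u) [AddCommGroup M] [Module A M] : M →ₗ[A] Dr A (Dl A M) where
  toFun m :=
    { toFun := fun f => f m
      map_add' := fun f g => rfl
      map_smul' := fun a f => rfl }
  map_add' m m' := by ext f; simp
  map_smul' a m := by ext f; simp

/-- The canonical evaluation map `φ_N : N → N**` for a right module `N`. -/
def evalR (N : Type u) [AddCommGroup N] [Module Aᵐᵒᵖ N] : N →ₗ[Aᵐᵒᵖ] Dl A (Dr A N) where
  toFun n :=
    { toFun := fun f => f n
      map_add' := fun f g => rfl
      map_smul' := fun a f => rfl }
  map_add' n n' := by ext f; simp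
  map_smul' a n := by ext f; simp

/-- The radical of a module: the intersection of all maximal submodules. -/
def radM (M : Type u) [AddCommGroup M] [Module A M] : Submodule A M :=
  sInf {N : Submodule A M | IsCoatom N}

/-- A module is *reduced* if it has no nonzero projective direct summand. -/
def Reduced (M : Type u) [AddCommGroup M] [Module A M] : Prop :=
  ∀ N N' : Submodule A M, IsCompl N N' → Module.Projective A N → N = ⊥

/-- Vanishing of `Ext^i_A(M, N)`. -/
def extZero (M N : Type u) [AddCommGroup M] [Module A M] [AddCommGroup N] [Module A N]
    (i : ℕ) : Prop :=
  Limits.IsZero (((Ext ℤ (ModuleCat.{u} A) i).obj (Opposite.op (ModuleCat.of A M))).obj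
    (ModuleCat.of A N))

/-- A left module `M` is semi-Gorenstein-projective if `Ext^i_A(M, A) = 0` for all `i ≥ 1`. -/
def sGp (M : Type u) [AddCommGroup M] [Module A M] : Prop :=
  ∀ i : ℕ, 1 ≤ i → extZero A M A i

/-- Semi-Gorenstein-projectivity for right modules, with `A` as right regular module. -/
def sGpR (N : Type u) [AddCommGroup N] [Module Aᵐᵒᵖ N] : Prop :=
  ∀ i : ℕ, 1 ≤ i → extZero Aᵐᵒᵖ N A i

/-- `e : P → M` is a projective cover: `P` is a finitely generated projective module,
`e` is surjective and `ker e ⊆ rad P`. -/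
def IsProjCover {P M : Type u} [AddCommGroup P] [Module A P] [AddCommGroup M] [Module A M]
    (e : P →ₗ[A] M) : Prop :=
  Module.Projective A P ∧ Module.Finite A P ∧ Function.Surjective e ∧ ker e ≤ radM A P

/-- `P₁ →f P₀ →e M → 0` is a minimal projective presentation of `M`. -/
def IsMinPres {P₁ P₀ M : Type u} [AddCommGroup P₁] [Module A P₁] [AddCommGroup P₀] [Module A P₀]
    [AddCommGroup M] [Module A M] (f : P₁ →ₗ[A] P₀) (e : P₀ →ₗ[A] M) : Prop :=
  IsProjCover A e ∧ range f = ker e ∧ Module.Projective A P₁ ∧ Module.Finite A P₁ ∧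
    ker f ≤ radM A P₁

/-- A minimal projective resolution `⋯ → P₁ → P₀ → M → 0` (ℕ-indexed). -/
def IsMinProjRes (P : ℕ → Type u) [∀ n, AddCommGroup (P n)] [∀ n, Module A (P n)]
    {M : Type u} [AddCommGroup M] [Module A M]
    (f : ∀ n, P (n+1) →ₗ[A] P n) (e : P 0 →ₗ[A] M) : Prop :=
  (∀ n, Module.Projective A (P n)) ∧ (∀ n, Module.Finite A (P n)) ∧
    Function.Surjective e ∧ range (f 0) = ker e ∧ (∀ n, range (f (n+1)) = ker (f n)) ∧
    ker e ≤ radM A (P 0) ∧ (∀ n, ker (f n) ≤ radM A (P (n+1)))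

section ZComplex

variable (P : ℤ → Type u) [∀ i, AddCommGroup (P i)] [∀ i, Module A (P i)]
  (g : ∀ i : ℤ, P i →ₗ[A] P (i-1))

/-- `(P_i, g_i : P_i → P_{i-1})` is a complex. -/
def IsComplexZ : Prop := ∀ i : ℤ, (g (i-1)).comp (g i) = 0

/-- A complex is minimal if each image lies in the radical. -/
def IsMinimalZ : Prop := ∀ i : ℤ, range (g i) ≤ radM A (P (i-1))

/-- A complex of (finitely generated) projective modules. -/
def IsProjComplexZ : Prop := ∀ i : ℤ, Module.Projective A (P i) ∧ Module.Finite A (P i)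

/-- Exactness at position `i - 1`, i.e. `H_{i-1}(P_•) = 0`. -/
def ExactAtPred (i : ℤ) : Prop := range (g i) = ker (g (i-1))

/-- Acyclicity of the `A`-dual complex `P_•^*`. -/
def DualAcyclicZ : Prop :=
  ∀ i : ℤ, range (dualMapL (g (i-1))) = ker (dualMapL (g i))

/-- The homology of the complex at position `i - 1`. -/
abbrev HomologyAtPred (i : ℤ) : Type u :=
  ↥(ker (g (i-1))) ⧸ (Submodule.comap (ker (g (i-1))).subtype (range (g i)))

end ZComplex

/-- `Z` is (a representative of) the transpose `Tr M` of the left module `M`. -/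
def IsTrL (M : Type u) [AddCommGroup M] [Module A M]
    (Z : Type u) [AddCommGroup Z] [Module Aᵐᵒᵖ Z] : Prop :=
  ∃ (P₁ P₀ : ModuleCat.{u} A) (f : P₁ →ₗ[A] P₀) (e : P₀ →ₗ[A] M),
    IsMinPres A f e ∧ Nonempty (Z ≃ₗ[Aᵐᵒᵖ] (Dl A P₁ ⧸ range (dualMapL f)))

/-- `M` is (a representative of) the transpose `Tr Z` of the right module `Z`. -/
def IsTrR (Z : Type u) [AddCommGroup Z] [Module Aᵐᵒᵖ Z]
    (M : Type u) [AddCommGroup M] [Module A M] : Prop :=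
  ∃ (Q₁ Q₀ : ModuleCat.{u} Aᵐᵒᵖ) (d : Q₁ →ₗ[Aᵐᵒᵖ] Q₀) (c : Q₀ →ₗ[Aᵐᵒᵖ] Z),
    IsMinPres Aᵐᵒᵖ d c ∧ Nonempty (M ≃ₗ[A] (Dr A Q₁ ⧸ range (dualMapR d)))

/-- `W` is (a representative of) the syzygy `Ω M` of the left module `M`. -/
def IsSyzL (W M : Type u) [AddCommGroup W] [Module A W] [AddCommGroup M] [Module A M] : Prop :=
  ∃ (P : ModuleCat.{u} A) (e : P →ₗ[A] M),
    IsProjCover A e ∧ Nonempty (W ≃ₗ[A] ker e)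

/-- `W` is (a representative of) the syzygy `Ω Z` of the right module `Z`. -/
def IsSyzR (W Z : Type u) [AddCommGroup W] [Module Aᵐᵒᵖ W] [AddCommGroup Z] [Module Aᵐᵒᵖ Z] :
    Prop :=
  ∃ (Q : ModuleCat.{u} Aᵐᵒᵖ) (c : Q →ₗ[Aᵐᵒᵖ] Z),
    IsProjCover Aᵐᵒᵖ c ∧ Nonempty (W ≃ₗ[Aᵐᵒᵖ] ker c)

/-- `W` is a second syzygy `Ω² M`. -/
def IsSyz2L (W M : Type u) [AddCommGroup W] [Module A W] [AddCommGroup M] [Module A M] : Prop :=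
  ∃ (V : ModuleCat.{u} A), IsSyzL A V M ∧ IsSyzL A W V

/-- `W` is a second syzygy `Ω² Z` of a right module. -/
def IsSyz2R (W Z : Type u) [AddCommGroup W] [Module Aᵐᵒᵖ W] [AddCommGroup Z] [Module Aᵐᵒᵖ Z] :
    Prop :=
  ∃ (V : ModuleCat.{u} Aᵐᵒᵖ), IsSyzR A V Z ∧ IsSyzR A W V

/-- A right module `Z` is ∞-torsionfree if its transpose is semi-Gorenstein-projective. -/
def InfTfR (Z : Type u) [AddCommGroup Z] [Module Aᵐᵒᵖ Z] : Prop :=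
  ∃ (M : ModuleCat.{u} A), IsTrR A Z M ∧ sGp A M

/-- A left module `M` is ∞-torsionfree if its transpose is semi-Gorenstein-projective. -/
def InfTfL (M : Type u) [AddCommGroup M] [Module A M] : Prop :=
  ∃ (Z : ModuleCat.{u} Aᵐᵒᵖ), IsTrL A M Z ∧ sGpR A Z

/-- Projective dimension at most `n` (for objects of `ModuleCat A`). -/
def projDimLEcat : ℕ → ModuleCat.{u} A → Prop
  | 0, M => Module.Projective A M
  | (n+1), M => ∃ (P : ModuleCat.{u} A) (e : P →ₗ[A] M),
      Module.Projective A P ∧ Module.Finite A P ∧ Function.Surjective e ∧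
        projDimLEcat n (ModuleCat.of A (ker e))

/-- Projective dimension at most `n`. -/
def projDimLE (M : Type u) [AddCommGroup M] [Module A M] (n : ℕ) : Prop :=
  projDimLEcat A n (ModuleCat.of A M)

/-- A Nunke module: a semi-Gorenstein-projective module `M` with `M* = 0`. -/
def NunkeL (M : Type u) [AddCommGroup M] [Module A M] : Prop :=
  sGp A M ∧ ∀ f : Dl A M, f = 0

end Preliminaries


/-- Reduced semi-Gorenstein-projective modules with projective dual. -/
def SgpDualProjClass (A : Type u) [Ring A] (M : Type u) [AddCommGroup M] [Module A M] : Prop :=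
  Module.Finite A M ∧ Reduced A M ∧ sGp A M ∧ Module.Projective Aᵐᵒᵖ (Dl A M)

/-- Reduced ∞-torsionfree right modules of projective dimension at most 2. -/
def TfPd2Class (A : Type u) [Ring A] (Z : Type u) [AddCommGroup Z] [Module Aᵐᵒᵖ Z] : Prop :=
  Module.Finite Aᵐᵒᵖ Z ∧ Reduced Aᵐᵒᵖ Z ∧ InfTfR A Z ∧ projDimLE Aᵐᵒᵖ Z 2

section Radical

variable {R : Type u} [Ring R] {M N : Type u} [AddCommGroup M] [Module R M]
  [AddCommGroup N] [Module R N]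

theorem map_mem_radM (f : M →ₗ[R] N) {m : M} (hm : m ∈ radM R M) : f m ∈ radM R N :=
  Module.le_comap_jacobson f hm

theorem eq_top_of_radM_sup_eq_top [Module.Finite R M] {X Y : Submodule R M}
    (hX : X ≤ radM R M) (h : X ⊔ Y = ⊤) : Y = ⊤ := by
  obtain hY | ⟨m, hm, hYm⟩ := eq_top_or_exists_le_coatom Y
  · exact hY
  · exact (hm.1 (top_le_iff.1 (h ▸ sup_le (hX.trans (sInf_le hm)) hYm))).elim

theorem subsingleton_of_radM_eq_top [Module.Finite R M] (h : radM R M = ⊤) :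
    Subsingleton M := by
  by_contra hM
  rw [not_subsingleton_iff_nontrivial] at hM
  exact (Module.jacobson_lt_top R M).ne h

theorem Reduced.subsingleton_of_surjective (hM : Reduced R M) [Module.Projective R N]
    (π : M →ₗ[R] N) (hπ : Function.Surjective π) : Subsingleton N := by
  obtain ⟨ι, hι⟩ := π.exists_rightInverse_of_surjective (range_eq_top.2 hπ)
  have hι' : ∀ n, π (ι n) = n := fun n => LinearMap.congr_fun hι n
  have hinj : Function.Injective ι := Function.LeftInverse.injective hι'
  have hc : IsCompl (range ι) (ker π) := by
    rw [isCompl_iff, Submodule.disjoint_def, codisjoint_iff, eq_top_iff]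
    refine ⟨?_, fun m _ => Submodule.mem_sup.2
      ⟨ι (π m), ⟨_, rfl⟩, m - ι (π m), by simp [hι'], by simp⟩⟩
    rintro _ ⟨n, rfl⟩ hn
    rw [mem_ker, hι'] at hn
    simp [hn]
  have h0 := hM _ _ hc (Module.Projective.of_equiv' (LinearEquiv.ofInjective ι hinj))
  refine ⟨fun a b => hinj ?_⟩
  rw [range_eq_bot.1 h0, LinearMap.zero_apply, LinearMap.zero_apply]

theorem Reduced.map_mem_radM_self [IsArtinianRing R] (hM : Reduced R M) (u : M →ₗ[R] R) (m : M) :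
    u m ∈ radM R R := by
  have key : ∀ m, IsNilpotent (u m) := by
    intro m
    set x := u m
    let r : Module.End R R := toSpanSingleton R R x
    have hr : ∀ (n : ℕ) (y : R), (r ^ n) y = y * x ^ n := by
      intro n y
      induction n with
      | zero => simp
      | succ n ih => rw [pow_succ', Module.End.mul_apply, ih]; simp [r, pow_succ, mul_assoc]
    obtain ⟨n, hn, hn1⟩ := (r.eventually_isCompl_ker_pow_range_pow.and
      (Filter.eventually_ge_atTop 1)).exists
    obtain ⟨k, rfl⟩ : ∃ k, n = k + 1 := ⟨n - 1, by omega⟩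
    have hproj : Module.Projective R (range (r ^ (k + 1))) :=
      Module.Projective.of_split (range (r ^ (k + 1))).subtype
        (Submodule.projectionOnto _ _ hn.symm) (by
          ext y; simp)
    have hsurj : Function.Surjective ((r ^ (k + 1)).rangeRestrict ∘ₗ u) := by
      rintro ⟨_, z, rfl⟩
      obtain ⟨a, ha, _, ⟨c, rfl⟩, rfl⟩ := Submodule.mem_sup.1
        (show z ∈ ker (r ^ (k + 1)) ⊔ range (r ^ (k + 1)) by rw [hn.sup_eq_top]; trivial)
      refine ⟨(c * x ^ k) • m, Subtype.ext ?_⟩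
      rw [mem_ker] at ha
      simp only [map_add, ha, zero_add]
      change (r ^ (k + 1)) (u ((c * x ^ k) • m)) = (r ^ (k + 1)) ((r ^ (k + 1)) c)
      rw [map_smul, hr, hr, hr, smul_eq_mul, pow_succ]
      simp only [x, mul_assoc]
    have hs := hM.subsingleton_of_surjective _ hsurj
    have h1 : (r ^ (k + 1)) 1 = 0 :=
      congrArg Subtype.val (Subsingleton.elim (⟨_, 1, rfl⟩ : range (r ^ (k + 1))) 0)
    exact ⟨k + 1, by simpa [hr] using h1⟩
  have : u m ∈ Ideal.jacobson (⊥ : Ideal R) := by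
    refine Ideal.mem_jacobson_iff.2 fun y => ?_
    have := key (y • m)
    rw [map_smul, smul_eq_mul] at this
    obtain ⟨z, hz⟩ := this.isUnit_one_add.exists_left_inv
    refine ⟨z, ?_⟩
    rw [Ideal.mem_bot, mul_assoc, ← hz]
    noncomm_ring
  rw [Ideal.jacobson_bot] at this
  exact this

end Radical

section DualBasis

variable {R : Type u} [Ring R] {P : Type u} [AddCommGroup P] [Module R P]

theorem exists_dual_basis (R P : Type u) [Ring R] [AddCommGroup P] [Module R P]
    [Module.Projective R P] [Module.Finite R P] :
    ∃ (n : ℕ) (x : Fin n → P) (φ : Fin n → P →ₗ[R] R), ∀ p, ∑ i, φ i p • x i = p := by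
  obtain ⟨n, f, hf⟩ := Module.Finite.exists_fin' R P
  obtain ⟨g, hg⟩ := f.exists_rightInverse_of_surjective (range_eq_top.2 hf)
  refine ⟨n, fun i => f (Pi.single i 1), fun i => proj i ∘ₗ g, fun p => ?_⟩
  have hp : f (g p) = p := LinearMap.congr_fun hg p
  conv_rhs => rw [← hp, ← Finset.univ_sum_single (g p), map_sum]
  refine Finset.sum_congr rfl fun i _ => ?_
  change g p i • f (Pi.single i 1) = _
  rw [← map_smul, ← Pi.single_smul, smul_eq_mul, mul_one]

theorem projective_finite_of_dual_basis {n : ℕ} (x : Fin n → P) (φ : Fin n → P →ₗ[R] R)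
    (h : ∀ p, ∑ i, φ i p • x i = p) : Module.Projective R P ∧ Module.Finite R P := by
  let s : (Fin n → R) →ₗ[R] P := Fintype.linearCombination R x
  have hs : s ∘ₗ LinearMap.pi φ = LinearMap.id := by
    ext p
    simpa [s, Fintype.linearCombination_apply] using h p
  exact ⟨Module.Projective.of_split _ _ hs, Module.Finite.of_surjective s
    (Function.LeftInverse.surjective (LinearMap.congr_fun hs))⟩

end DualBasis

section Biregular

/-- `D` is an `R`-`S`-bimodule that is free of rank one on `d` over both rings. -/
structure IsBiregular (R S : Type u) {D : Type u} [Ring R] [Ring S] [AddCommGroup D] [Module R D]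
    [Module S D] (d : D) : Prop where
  left : Function.Bijective fun r : R => r • d
  right : Function.Bijective fun s : S => s • d

variable {R S D : Type u} [Ring R] [Ring S] [AddCommGroup D] [Module R D] [Module S D] {d : D}

theorem IsBiregular.symm (h : IsBiregular R S d) : IsBiregular S R d := ⟨h.right, h.left⟩

/-- The isomorphism `R ≃ D` given by the left generator. -/
noncomputable def IsBiregular.equiv (h : IsBiregular R S d) : R ≃ₗ[R] D :=
  LinearEquiv.ofBijective (toSpanSingleton R D d) h.left

theorem IsBiregular.equiv_apply (h : IsBiregular R S d) (r : R) : h.equiv r = r • d := rfl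

theorem IsBiregular.equiv_symm_smul (h : IsBiregular R S d) (x : D) : h.equiv.symm x • d = x :=
  h.equiv.apply_symm_apply x

variable [SMulCommClass R S D]

theorem IsBiregular.mem_radM [IsArtinianRing R] (h : IsBiregular R S d) {x : D}
    (hx : x ∈ radM R D) : x ∈ radM S D := by
  obtain ⟨s, rfl⟩ := h.right.2 x
  refine map_mem_radM (toSpanSingleton S D d) (m := s) ?_
  suffices s ∈ Ideal.jacobson (⊥ : Ideal S) by
    rw [Ideal.jacobson_bot] at this
    exact this
  refine Ideal.mem_jacobson_iff.2 fun y => ?_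
  let ly : D →ₗ[R] D := ⟨⟨fun v => y • v, smul_add y⟩, fun r v => (smul_comm r y v).symm⟩
  have hy : (y * s) • d ∈ radM R D := by
    rw [mul_smul]
    exact map_mem_radM ly hx
  obtain ⟨r, hr⟩ := h.left.2 ((y * s) • d)
  have hr' : r ∈ Ideal.jacobson (⊥ : Ideal R) := by
    rw [Ideal.jacobson_bot]
    have := map_mem_radM h.equiv.symm.toLinearMap hy
    rw [← hr] at this
    change h.equiv.symm (h.equiv r) ∈ _ at this
    rwa [LinearEquiv.symm_apply_apply] at this
  obtain ⟨z, hz⟩ := Ideal.exists_mul_add_sub_mem_of_mem_jacobson r hr'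
  rw [Ideal.mem_bot, sub_eq_zero] at hz
  have hz' : (r + 1) * z = 1 := mul_eq_one_comm.1 hz
  obtain ⟨w, hw⟩ := h.right.2 (z • d)
  simp only at hr hw
  refine ⟨w, ?_⟩
  rw [Ideal.mem_bot]
  apply h.right.1
  simp only [sub_smul, add_smul, mul_assoc, one_smul, zero_smul]
  rw [mul_smul, ← hr, ← smul_comm, hw, ← mul_smul, ← add_smul, ← add_one_mul, hz', one_smul,
    sub_self]

variable {P : Type u} [AddCommGroup P] [Module R P]

theorem IsBiregular.exists_dual_basis (h : IsBiregular R S d) (P : Type u) [AddCommGroup P]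
    [Module R P] [Module.Projective R P] [Module.Finite R P] :
    ∃ (n : ℕ) (x : Fin n → P) (φ : Fin n → P →ₗ[R] D) (σ : Fin n → (P →ₗ[R] D) →ₗ[S] S),
      (∀ p, ∑ i, h.equiv.symm (φ i p) • x i = p) ∧ (∀ g i, σ i g • d = g (x i)) ∧
        ∀ g, ∑ i, σ i g • φ i = g := by
  obtain ⟨n, x, φ, hφ⟩ := _root_.exists_dual_basis R P
  have hσ : ∀ (g : P →ₗ[R] D) i, h.symm.equiv.symm (g (x i)) • d = g (x i) :=
    fun g i => h.symm.equiv_symm_smul _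
  refine ⟨n, x, fun i => h.equiv.toLinearMap ∘ₗ φ i,
    fun i => h.symm.equiv.symm.toLinearMap ∘ₗ applyₗ' S (x i), ?_, hσ, ?_⟩
  · simpa using hφ
  · intro g
    ext p
    conv_rhs => rw [← hφ p]
    simp only [LinearMap.sum_apply, LinearMap.smul_apply, map_sum, map_smul]
    refine Finset.sum_congr rfl fun i _ => ?_
    change h.symm.equiv.symm (g (x i)) • φ i p • d = _
    rw [← smul_comm, hσ]

theorem IsBiregular.projective_finite_dual (h : IsBiregular R S d) [Module.Projective R P]
    [Module.Finite R P] : Module.Projective S (P →ₗ[R] D) ∧ Module.Finite S (P →ₗ[R] D) := by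
  obtain ⟨n, x, φ, σ, -, -, h3⟩ := h.exists_dual_basis P
  exact projective_finite_of_dual_basis φ σ h3

theorem IsBiregular.mem_radM_dual [IsArtinianRing R] (h : IsBiregular R S d)
    [Module.Projective R P] [Module.Finite R P] {g : P →ₗ[R] D} (hg : ∀ p, g p ∈ radM R D) :
    g ∈ radM S (P →ₗ[R] D) := by
  obtain ⟨n, x, φ, σ, -, h2, h3⟩ := h.exists_dual_basis P
  rw [← h3 g]
  refine Submodule.sum_mem _ fun i _ => map_mem_radM (toSpanSingleton S _ (φ i)) (m := σ i g) ?_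
  have := map_mem_radM h.symm.equiv.symm.toLinearMap (h.mem_radM (hg (x i)))
  rw [← h2] at this
  change h.symm.equiv.symm (h.symm.equiv (σ i g)) ∈ _ at this
  rwa [LinearEquiv.symm_apply_apply] at this

theorem IsBiregular.eq_zero_of_dual_apply_eq_zero (h : IsBiregular R S d) [Module.Projective R P]
    [Module.Finite R P] {p : P} (hp : ∀ g : P →ₗ[R] D, g p = 0) : p = 0 := by
  obtain ⟨n, x, φ, σ, h1, -, -⟩ := h.exists_dual_basis P
  rw [← h1 p]
  simp [hp]

/-- A projective module all of whose functionals are radical-valued vanishes. -/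
theorem IsBiregular.subsingleton_of_dual_mem_radM (h : IsBiregular R S d) [Module.Projective R P]
    [Module.Finite R P] (hP : ∀ (g : P →ₗ[R] D) p, g p ∈ radM R D) : Subsingleton P := by
  obtain ⟨n, x, φ, σ, h1, -, -⟩ := h.exists_dual_basis P
  refine subsingleton_of_radM_eq_top (R := R) (eq_top_iff.2 fun p _ => ?_)
  rw [← h1 p]
  exact Submodule.sum_mem _ fun i _ => map_mem_radM
    (toSpanSingleton R _ (x i) ∘ₗ h.equiv.symm.toLinearMap) (hP (φ i) p)

variable [SMulCommClass S R D]

/-- The evaluation map into the double dual. -/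
def evalDual (R S D P : Type u) [Ring R] [Ring S] [AddCommGroup D] [Module R D] [Module S D]
    [SMulCommClass R S D] [SMulCommClass S R D] [AddCommGroup P] [Module R P] :
    P →ₗ[R] ((P →ₗ[R] D) →ₗ[S] D) where
  toFun p := applyₗ' S p
  map_add' p q := by ext g; simp
  map_smul' r p := by ext g; simp

theorem evalDual_apply (p : P) (g : P →ₗ[R] D) : evalDual R S D P p g = g p := rfl

theorem IsBiregular.evalDual_bijective (h : IsBiregular R S d) [Module.Projective R P]
    [Module.Finite R P] : Function.Bijective (evalDual R S D P) := by
  refine ⟨(injective_iff_map_eq_zero _).2 fun p hp =>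
    h.eq_zero_of_dual_apply_eq_zero (LinearMap.congr_fun hp), fun ξ => ?_⟩
  obtain ⟨n, x, φ, σ, -, h2, h3⟩ := h.exists_dual_basis P
  refine ⟨∑ i, h.equiv.symm (ξ (φ i)) • x i, ?_⟩
  ext g
  conv_rhs => rw [← h3 g]
  rw [evalDual_apply, map_sum, map_sum]
  refine Finset.sum_congr rfl fun i _ => ?_
  rw [map_smul, map_smul, ← h2, smul_comm, h.equiv_symm_smul]

end Biregular

section Presentation

variable {R : Type u} [Ring R] {P P' P₁ P₀ P₁' P₀' M M' : Type u}
  [AddCommGroup P] [Module R P] [AddCommGroup P'] [Module R P']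
  [AddCommGroup P₁] [Module R P₁] [AddCommGroup P₀] [Module R P₀]
  [AddCommGroup P₁'] [Module R P₁'] [AddCommGroup P₀'] [Module R P₀']
  [AddCommGroup M] [Module R M] [AddCommGroup M'] [Module R M']

theorem Reduced.of_equiv (hM : Reduced R M) (m : M ≃ₗ[R] M') : Reduced R M' := by
  intro N N' hc hN
  have hc' := (Submodule.orderIsoMapComap m.symm).isCompl hc
  have h0 := hM _ _ hc' (Module.Projective.of_equiv' (m.symm.submoduleMap N))
  exact (map_eq_bot_iff (Submodule.orderIsoMapComap m.symm)).1 h0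

theorem extZero.of_equiv {N : Type u} [AddCommGroup N] [Module R N] {i : ℕ}
    (h : extZero R M N i) (m : M ≃ₗ[R] M') : extZero R M' N i :=
  Limits.IsZero.of_iso h
    (((Ext ℤ (ModuleCat.{u} R) i).mapIso m.toModuleIso.op).app (ModuleCat.of R N))

theorem exists_factor_of_ker_le {N : Type u} [AddCommGroup N] [Module R N] {e : P →ₗ[R] M}
    {g : P →ₗ[R] N} (he : Function.Surjective e) (h : ker e ≤ ker g) :
    ∃ u : M →ₗ[R] N, ∀ p, u (e p) = g p := by
  refine ⟨(ker e).liftQ g h ∘ₗ (e.quotKerEquivOfSurjective he).symm.toLinearMap, fun p => ?_⟩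
  have hq : (e.quotKerEquivOfSurjective he).symm (e p) = (ker e).mkQ p := by
    rw [LinearEquiv.symm_apply_eq]; rfl
  rw [LinearMap.comp_apply, LinearEquiv.coe_coe, hq]
  rfl

theorem IsProjCover.exists_surjective_lift {e : P →ₗ[R] M} {e' : P' →ₗ[R] M}
    (h : IsProjCover R e) (h' : IsProjCover R e') :
    ∃ a : P →ₗ[R] P', Function.Surjective a ∧ ∀ p, e' (a p) = e p := by
  obtain ⟨hP, -, he, -⟩ := h
  obtain ⟨-, hf, he', hk⟩ := h'
  obtain ⟨a, ha⟩ := Module.projective_lifting_property e' e he'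
  have ha' : ∀ p, e' (a p) = e p := LinearMap.congr_fun ha
  refine ⟨a, range_eq_top.1 (eq_top_of_radM_sup_eq_top hk (eq_top_iff.2 fun q _ => ?_)), ha'⟩
  obtain ⟨p, hp⟩ := he (e' q)
  exact Submodule.mem_sup.2 ⟨q - a p, by simp [ha', hp], a p, ⟨p, rfl⟩, by simp⟩

theorem IsProjCover.exists_equiv [IsNoetherianRing R] {e : P →ₗ[R] M} {e' : P' →ₗ[R] M}
    (h : IsProjCover R e) (h' : IsProjCover R e') :
    ∃ a : P ≃ₗ[R] P', ∀ p, e' (a p) = e p := by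
  obtain ⟨a, ha, hae⟩ := h.exists_surjective_lift h'
  obtain ⟨b, hb, -⟩ := h'.exists_surjective_lift h
  have := h.2.1
  have hinj : Function.Injective (b ∘ₗ a) :=
    IsNoetherian.injective_of_surjective_endomorphism _ (hb.comp ha)
  exact ⟨LinearEquiv.ofBijective a ⟨Function.Injective.of_comp hinj, ha⟩, hae⟩

theorem IsMinPres.of_equiv {f : P₁ →ₗ[R] P₀} {e : P₀ →ₗ[R] M} (h : IsMinPres R f e)
    (m : M ≃ₗ[R] M') : IsMinPres R f (m.toLinearMap ∘ₗ e) := by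
  obtain ⟨⟨h1, h2, h3, h4⟩, h5, h6⟩ := h
  have hk : ker (m.toLinearMap ∘ₗ e) = ker e := by
    ext; simp
  exact ⟨⟨h1, h2, m.surjective.comp h3, hk ▸ h4⟩, hk ▸ h5, h6⟩

theorem IsMinPres.exists_equiv [IsNoetherianRing R] {f : P₁ →ₗ[R] P₀} {e : P₀ →ₗ[R] M}
    {f' : P₁' →ₗ[R] P₀'} {e' : P₀' →ₗ[R] M} (h : IsMinPres R f e) (h' : IsMinPres R f' e') :
    ∃ (b : P₁ ≃ₗ[R] P₁') (a : P₀ ≃ₗ[R] P₀'), ∀ p, f' (b p) = a (f p) := by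
  obtain ⟨hc, hr, hp, hf, hk⟩ := h
  obtain ⟨hc', hr', hp', hf', hk'⟩ := h'
  obtain ⟨a, ha⟩ := hc.exists_equiv hc'
  have hfe : ∀ p, e (f p) = 0 := fun p => mem_ker.1 (hr ▸ ⟨p, rfl⟩)
  let g : P₁ →ₗ[R] ker e' := (a.toLinearMap ∘ₗ f).codRestrict _ fun p => by simp [ha, hfe]
  let g' : P₁' →ₗ[R] ker e' := f'.codRestrict _ fun p => hr' ▸ ⟨p, rfl⟩
  have hg : IsProjCover R g := by
    refine ⟨hp, hf, ?_, ?_⟩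
    · rintro ⟨q, hq⟩
      have : a.symm q ∈ range f := by
        rw [hr, mem_ker, ← ha, a.apply_symm_apply, mem_ker.1 hq]
      obtain ⟨p, hp⟩ := this
      exact ⟨p, Subtype.ext (by simp [g, hp])⟩
    · simpa [g, ker_codRestrict, LinearEquiv.ker_comp] using hk
  have hg' : IsProjCover R g' := by
    refine ⟨hp', hf', ?_, ?_⟩
    · rintro ⟨q, hq⟩
      obtain ⟨p, hp⟩ := hr' ▸ hq
      exact ⟨p, Subtype.ext hp⟩
    · simpa [g', ker_codRestrict] using hk'
  obtain ⟨b, hb⟩ := hg.exists_equiv hg'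
  exact ⟨b, a, fun p => congrArg Subtype.val (hb p)⟩

theorem projDimLE_two_of_presentation {f : P₁ →ₗ[R] P₀} {e : P₀ →ₗ[R] M}
    [Module.Projective R P₁] [Module.Finite R P₁] [Module.Projective R P₀] [Module.Finite R P₀]
    (he : Function.Surjective e) (hr : range f = ker e) (hf : Module.Projective R (ker f)) :
    projDimLE R M 2 := by
  let g : P₁ →ₗ[R] ker e := f.codRestrict _ fun p => hr ▸ ⟨p, rfl⟩
  have hg : Function.Surjective g := by
    rintro ⟨q, hq⟩
    obtain ⟨p, hp⟩ := hr ▸ hq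
    exact ⟨p, Subtype.ext hp⟩
  have hk : ker g = ker f := ker_codRestrict _ _ _
  refine ⟨ModuleCat.of R P₀, e, ‹_›, ‹_›, he, ModuleCat.of R P₁, g, ‹_›, ‹_›, hg, ?_⟩
  change Module.Projective R (ker g)
  rwa [hk]

theorem hasProjectiveDimensionLT_iff_ker [Module.Projective R P] (e : P →ₗ[R] M)
    (he : Function.Surjective e) (n : ℕ) :
    HasProjectiveDimensionLT (ModuleCat.of R M) (n + 2) ↔
      HasProjectiveDimensionLT (ModuleCat.of R (ker e)) (n + 1) := by
  let T : ShortComplex (ModuleCat.{u} R) :=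
    ShortComplex.mk (ModuleCat.ofHom (ker e).subtype) (ModuleCat.ofHom e) (by ext x; simp)
  have hT : T.ShortExact := ModuleCat.shortComplex_shortExact T
    (LinearMap.exact_subtype_ker_map e) (Submodule.subtype_injective _) he
  exact hT.hasProjectiveDimensionLT_X₃_iff n ((IsProjective.iff_projective P).1 ‹_›)

theorem hasProjectiveDimensionLT_of_projDimLEcat (n : ℕ) (M : ModuleCat.{u} R)
    (h : projDimLEcat R n M) : HasProjectiveDimensionLT M (n + 1) := by
  induction n generalizing M with
  | zero =>
    have : Projective M := (IsProjective.iff_projective (M : Type u)).1 h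
    infer_instance
  | succ n ih =>
    obtain ⟨P, e, hP, -, he, hk⟩ := h
    exact (hasProjectiveDimensionLT_iff_ker e he n).2 (ih _ hk)

theorem projDimLE.projective_ker {f : P₁ →ₗ[R] P₀} {e : P₀ →ₗ[R] M} (h : projDimLE R M 2)
    [Module.Projective R P₁] [Module.Projective R P₀]
    (he : Function.Surjective e) (hr : range f = ker e) : Module.Projective R (ker f) := by
  let g : P₁ →ₗ[R] ker e := f.codRestrict _ fun p => hr ▸ ⟨p, rfl⟩
  have hg : Function.Surjective g := by
    rintro ⟨q, hq⟩
    obtain ⟨p, hp⟩ := hr ▸ hq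
    exact ⟨p, Subtype.ext hp⟩
  have hk : ker g = ker f := ker_codRestrict _ _ _
  have h1 := (hasProjectiveDimensionLT_iff_ker e he 1).1
    (hasProjectiveDimensionLT_of_projDimLEcat 2 _ h)
  have h2 := (hasProjectiveDimensionLT_iff_ker g hg 0).1 h1
  rw [← hk, IsProjective.iff_projective]
  exact projective_iff_hasProjectiveDimensionLT_one.2 h2

end Presentation

section Transpose

variable {R S D : Type u} [Ring R] [Ring S] [AddCommGroup D] [Module R D] [Module S D]
  [SMulCommClass R S D] {d : D}
  {P₁ P₀ P₁' P₀' M : Type u}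
  [AddCommGroup P₁] [Module R P₁] [AddCommGroup P₀] [Module R P₀]
  [AddCommGroup P₁'] [Module R P₁'] [AddCommGroup P₀'] [Module R P₀']
  [AddCommGroup M] [Module R M]

theorem IsMinPres.nonempty_coker_equiv [IsNoetherianRing R] {f : P₁ →ₗ[R] P₀} {e : P₀ →ₗ[R] M}
    {f' : P₁' →ₗ[R] P₀'} {e' : P₀' →ₗ[R] M} (h : IsMinPres R f e) (h' : IsMinPres R f' e') :
    Nonempty (((P₁ →ₗ[R] D) ⧸ range (lcomp S D f)) ≃ₗ[S]
      ((P₁' →ₗ[R] D) ⧸ range (lcomp S D f'))) := by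
  obtain ⟨b, a, hab⟩ := h.exists_equiv h'
  refine ⟨Submodule.Quotient.equiv _ _ (LinearEquiv.congrLeft D S b) ?_⟩
  ext u
  simp only [Submodule.mem_map, mem_range]
  constructor
  · rintro ⟨_, ⟨v, rfl⟩, rfl⟩
    refine ⟨v ∘ₗ a.symm.toLinearMap, ?_⟩
    ext p
    obtain ⟨q, rfl⟩ := b.surjective p
    change v (a.symm (f' (b q))) = v (f (b.symm (b q)))
    rw [hab]; simp
  · rintro ⟨v, rfl⟩
    refine ⟨_, ⟨v ∘ₗ a.toLinearMap, rfl⟩, ?_⟩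
    ext p
    obtain ⟨q, rfl⟩ := b.surjective p
    change v (a (f (b.symm (b q)))) = v (f' (b q))
    rw [hab]; simp

theorem IsMinPres.dual [IsArtinianRing R] (h : IsBiregular R S d) {f : P₁ →ₗ[R] P₀}
    {e : P₀ →ₗ[R] M} (hp : IsMinPres R f e) (hM : Reduced R M) :
    IsMinPres S (lcomp S D f) (range (lcomp S D f)).mkQ := by
  obtain ⟨⟨_, _, hs, hk⟩, hr, _, _, -⟩ := hp
  have h1 := h.projective_finite_dual (P := P₁)
  have h0 := h.projective_finite_dual (P := P₀)
  refine ⟨⟨h1.1, h1.2, Submodule.mkQ_surjective _, ?_⟩, (Submodule.ker_mkQ _).symm,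
    h0.1, h0.2, ?_⟩
  · rw [Submodule.ker_mkQ]
    rintro _ ⟨g, rfl⟩
    exact h.mem_radM_dual fun p => map_mem_radM g (hk (hr ▸ ⟨p, rfl⟩))
  · intro g hg
    refine h.mem_radM_dual fun p => ?_
    have hle : ker e ≤ ker g := by
      rw [← hr]
      rintro _ ⟨q, rfl⟩
      exact LinearMap.congr_fun (mem_ker.1 hg) q
    obtain ⟨u, hu⟩ := exists_factor_of_ker_le hs hle
    rw [← hu p]
    have := map_mem_radM h.equiv.toLinearMap
      (hM.map_mem_radM_self (h.equiv.symm.toLinearMap ∘ₗ u) (e p))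
    simpa using this

/-- The functionals on `M` are the functionals on `P₀` killed by the dual of `P₁ → P₀`. -/
theorem nonempty_dual_equiv_ker_lcomp {f : P₁ →ₗ[R] P₀} {e : P₀ →ₗ[R] M}
    (hs : Function.Surjective e) (hr : range f = ker e) :
    Nonempty ((M →ₗ[R] D) ≃ₗ[S] ker (lcomp S D f)) := by
  have hfe : ∀ p, e (f p) = 0 := fun p => mem_ker.1 (hr ▸ ⟨p, rfl⟩)
  refine ⟨LinearEquiv.ofBijective ((lcomp S D e).codRestrict _ fun u => ?_) ⟨?_, ?_⟩⟩
  · ext p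
    change u (e (f p)) = 0
    rw [hfe, map_zero]
  · intro u v huv
    ext m
    obtain ⟨p, rfl⟩ := hs m
    exact LinearMap.congr_fun (congrArg Subtype.val huv) p
  · rintro ⟨g, hg⟩
    have hle : ker e ≤ ker g := by
      rw [← hr]
      rintro _ ⟨q, rfl⟩
      exact LinearMap.congr_fun (mem_ker.1 hg) q
    obtain ⟨u, hu⟩ := exists_factor_of_ker_le hs hle
    exact ⟨u, Subtype.ext (LinearMap.ext hu)⟩

/-- `Z` represents the transpose of `M`, formed with the dualizing bimodule `D`. -/
def IsTranspose (R S D M Z : Type u) [Ring R] [Ring S] [AddCommGroup D] [Module R D] [Module S D]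
    [SMulCommClass R S D] [AddCommGroup M] [Module R M] [AddCommGroup Z] [Module S Z] : Prop :=
  ∃ (P₁ P₀ : ModuleCat.{u} R) (f : P₁ →ₗ[R] P₀) (e : P₀ →ₗ[R] M),
    IsMinPres R f e ∧ Nonempty (Z ≃ₗ[S] ((P₁ →ₗ[R] D) ⧸ range (lcomp S D f)))

variable {Z Z' : Type u} [AddCommGroup Z] [Module S Z] [AddCommGroup Z'] [Module S Z']

theorem IsTranspose.nonempty_equiv [IsNoetherianRing R] (hZ : IsTranspose R S D M Z)
    (hZ' : IsTranspose R S D M Z') : Nonempty (Z ≃ₗ[S] Z') := by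
  obtain ⟨P₁, P₀, f, e, hp, ⟨θ⟩⟩ := hZ
  obtain ⟨P₁', P₀', f', e', hp', ⟨θ'⟩⟩ := hZ'
  obtain ⟨E⟩ := hp.nonempty_coker_equiv (S := S) (D := D) hp'
  exact ⟨(θ.trans E).trans θ'.symm⟩

theorem IsTranspose.finite (h : IsBiregular R S d) (hZ : IsTranspose R S D M Z) :
    Module.Finite S Z := by
  obtain ⟨P₁, P₀, f, e, hp, ⟨θ⟩⟩ := hZ
  obtain ⟨-, -, _, _, -⟩ := hp
  have := (h.projective_finite_dual (P := P₁)).2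
  exact Module.Finite.equiv θ.symm

theorem IsTranspose.projDimLE_two (h : IsBiregular R S d) (hZ : IsTranspose R S D M Z)
    (hM : Module.Projective S (M →ₗ[R] D)) : projDimLE S Z 2 := by
  obtain ⟨P₁, P₀, f, e, hp, ⟨θ⟩⟩ := hZ
  obtain ⟨⟨_, _, hs, -⟩, hr, _, _, -⟩ := hp
  obtain ⟨_, _⟩ := h.projective_finite_dual (P := P₁)
  obtain ⟨_, _⟩ := h.projective_finite_dual (P := P₀)
  obtain ⟨E⟩ := nonempty_dual_equiv_ker_lcomp (S := S) (D := D) hs hr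
  refine projDimLE_two_of_presentation (f := lcomp S D f)
    (e := θ.symm.toLinearMap ∘ₗ (range (lcomp S D f)).mkQ)
    (θ.symm.surjective.comp (Submodule.mkQ_surjective _)) ?_ (Module.Projective.of_equiv' E)
  rw [LinearEquiv.ker_comp, Submodule.ker_mkQ]

variable [SMulCommClass S R D]

theorem IsMinPres.reduced_coker_dual (h : IsBiregular R S d) [IsArtinianRing R] [IsArtinianRing S]
    {f : P₁ →ₗ[R] P₀} {e : P₀ →ₗ[R] M} (hp : IsMinPres R f e) :
    Reduced S ((P₁ →ₗ[R] D) ⧸ range (lcomp S D f)) := by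
  obtain ⟨⟨_, _, -, -⟩, -, _, _, hk⟩ := hp
  intro N N' hc hN
  let π : (P₁ →ₗ[R] D) →ₗ[S] N := N.projectionOnto N' hc ∘ₗ (range (lcomp S D f)).mkQ
  have hπ : Function.Surjective π :=
    (Submodule.projectionOnto_surjective hc).comp (Submodule.mkQ_surjective _)
  have := (h.projective_finite_dual (P := P₁)).2
  have hfin : Module.Finite S N := Module.Finite.of_surjective π hπ
  have hsub : Subsingleton N := by
    refine h.symm.subsingleton_of_dual_mem_radM fun ψ n => ?_
    obtain ⟨g, rfl⟩ := hπ n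
    obtain ⟨p, hp⟩ := h.evalDual_bijective.2 (ψ ∘ₗ π)
    have hfp : f p = 0 := by
      refine h.eq_zero_of_dual_apply_eq_zero fun v => ?_
      have h1 : v (f p) = ψ (π (lcomp S D f v)) := LinearMap.congr_fun hp (lcomp S D f v)
      have h2 : (range (lcomp S D f)).mkQ (lcomp S D f v) = 0 :=
        (Submodule.Quotient.mk_eq_zero _).2 ⟨v, rfl⟩
      rw [h1, LinearMap.comp_apply, h2, map_zero, map_zero]
    have h3 : g p = ψ (π g) := LinearMap.congr_fun hp g
    rw [← h3]
    exact h.mem_radM (map_mem_radM g (hk hfp))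
  exact (Submodule.subsingleton_iff_eq_bot).1 hsub

theorem IsMinPres.nonempty_equiv_coker_double_dual (h : IsBiregular R S d)
    {f : P₁ →ₗ[R] P₀} {e : P₀ →ₗ[R] M} (hp : IsMinPres R f e) :
    Nonempty (M ≃ₗ[R] (((P₀ →ₗ[R] D) →ₗ[S] D) ⧸ range (lcomp R D (lcomp S D f)))) := by
  obtain ⟨⟨_, _, hs, -⟩, hr, _, _, -⟩ := hp
  refine ⟨(e.quotKerEquivOfSurjective hs).symm.trans (Submodule.Quotient.equiv _ _
    (LinearEquiv.ofBijective _ h.evalDual_bijective) ?_)⟩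
  rw [← hr]
  ext ξ
  constructor
  · rintro ⟨_, ⟨p, rfl⟩, rfl⟩
    exact ⟨evalDual R S D P₁ p, rfl⟩
  · rintro ⟨η, rfl⟩
    obtain ⟨p, rfl⟩ := h.evalDual_bijective.2 η
    exact ⟨_, ⟨p, rfl⟩, rfl⟩

theorem IsMinPres.nonempty_ker_equiv_dual (h : IsBiregular R S d)
    {f : P₁ →ₗ[R] P₀} {e : P₀ →ₗ[R] M} (hp : IsMinPres R f e) :
    Nonempty (ker f ≃ₗ[R] (((P₁ →ₗ[R] D) ⧸ range (lcomp S D f)) →ₗ[S] D)) := by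
  obtain ⟨⟨_, _, -, -⟩, -, _, _, -⟩ := hp
  obtain ⟨E⟩ := nonempty_dual_equiv_ker_lcomp (R := S) (S := R) (D := D)
    (f := lcomp S D f) (e := (range (lcomp S D f)).mkQ) (Submodule.mkQ_surjective _)
    (Submodule.ker_mkQ _).symm
  let ev := LinearEquiv.ofBijective _ (h.evalDual_bijective (P := P₁))
  refine ⟨(LinearEquiv.ofSubmodules ev (ker f) _ ?_).trans E.symm⟩
  ext ξ
  obtain ⟨p, rfl⟩ := ev.surjective ξ
  constructor
  · rintro ⟨q, hq, hqp⟩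
    obtain rfl := ev.injective hqp
    ext v
    change v (f q) = 0
    rw [mem_ker.1 hq, map_zero]
  · intro hξ
    exact ⟨p, h.eq_zero_of_dual_apply_eq_zero fun v => LinearMap.congr_fun (mem_ker.1 hξ) v, rfl⟩

theorem IsTranspose.symm (h : IsBiregular R S d) [IsArtinianRing R] (hZ : IsTranspose R S D M Z)
    (hM : Reduced R M) : IsTranspose S R D Z M := by
  obtain ⟨P₁, P₀, f, e, hp, ⟨θ⟩⟩ := hZ
  exact ⟨ModuleCat.of S (P₀ →ₗ[R] D), ModuleCat.of S (P₁ →ₗ[R] D), lcomp S D f, _,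
    (hp.dual h hM).of_equiv θ.symm, hp.nonempty_equiv_coker_double_dual h⟩

theorem IsTranspose.reduced (h : IsBiregular R S d) [IsArtinianRing R] [IsArtinianRing S]
    (hZ : IsTranspose R S D M Z) : Reduced S Z := by
  obtain ⟨P₁, P₀, f, e, hp, ⟨θ⟩⟩ := hZ
  exact (hp.reduced_coker_dual h).of_equiv θ.symm

theorem IsTranspose.projective_dual (h : IsBiregular R S d) (hZ : IsTranspose R S D M Z)
    (hM : projDimLE R M 2) : Module.Projective R (Z →ₗ[S] D) := by
  obtain ⟨P₁, P₀, f, e, hp, ⟨θ⟩⟩ := hZ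
  obtain ⟨E⟩ := hp.nonempty_ker_equiv_dual h
  obtain ⟨⟨_, _, hs, -⟩, hr, _, _, -⟩ := hp
  have := hM.projective_ker hs hr
  exact Module.Projective.of_equiv' (E.trans (LinearEquiv.congrLeft D R θ.symm))

end Transpose

theorem isBiregular_one (A : Type u) [Ring A] : IsBiregular A Aᵐᵒᵖ (1 : A) where
  left := by simpa using! Function.bijective_id
  right := by simpa using MulOpposite.unop_bijective

theorem isTrL_iff_isTranspose (A M Z : Type u) [Ring A] [AddCommGroup M] [Module A M]
    [AddCommGroup Z] [Module Aᵐᵒᵖ Z] : IsTrL A M Z ↔ IsTranspose A Aᵐᵒᵖ A M Z := Iff.rfl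

theorem isTrR_iff_isTranspose (A M Z : Type u) [Ring A] [AddCommGroup M] [Module A M]
    [AddCommGroup Z] [Module Aᵐᵒᵖ Z] : IsTrR A Z M ↔ IsTranspose Aᵐᵒᵖ A A Z M := Iff.rfl

/-- Proposition 3.3 (first part): `Tr` is a bijection between the iso classes of reduced
semi-Gorenstein-projective modules with projective dual, and the iso classes of reduced
∞-torsionfree right modules of projective dimension at most 2. -/
theorem transpose_bijection_dual_projective (k : Type u) [CommRing k] [IsArtinianRing k]
    (A : Type u) [Ring A] [Algebra k A] [Module.Finite k A] :
    (∀ M : ModuleCat.{u} A, SgpDualProjClass A (↥M) →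
      ∀ Z : ModuleCat.{u} Aᵐᵒᵖ, IsTrL A (↥M) (↥Z) → TfPd2Class A (↥Z)) ∧
    (∀ Z : ModuleCat.{u} Aᵐᵒᵖ, TfPd2Class A (↥Z) →
      ∀ M : ModuleCat.{u} A, IsTrR A (↥Z) (↥M) → SgpDualProjClass A (↥M)) ∧
    (∀ M : ModuleCat.{u} A, SgpDualProjClass A (↥M) →
      ∀ Z : ModuleCat.{u} Aᵐᵒᵖ, IsTrL A (↥M) (↥Z) →
        ∀ M' : ModuleCat.{u} A, IsTrR A (↥Z) (↥M') → Nonempty ((↥M') ≃ₗ[A] (↥M))) ∧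
    (∀ Z : ModuleCat.{u} Aᵐᵒᵖ, TfPd2Class A (↥Z) →
      ∀ M : ModuleCat.{u} A, IsTrR A (↥Z) (↥M) →
        ∀ Z' : ModuleCat.{u} Aᵐᵒᵖ, IsTrL A (↥M) (↥Z') → Nonempty ((↥Z') ≃ₗ[Aᵐᵒᵖ] (↥Z))) := by
  have hA : IsArtinianRing A := IsArtinianRing.of_finite k A
  have hAop : IsArtinianRing Aᵐᵒᵖ := IsArtinianRing.of_finite k Aᵐᵒᵖ
  have h := isBiregular_one A
  simp only [isTrL_iff_isTranspose, isTrR_iff_isTranspose]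
  refine ⟨?_, ?_, ?_, ?_⟩
  · rintro M ⟨-, hr, hs, hd⟩ Z hZ
    exact ⟨hZ.finite h, hZ.reduced h, ⟨M, hZ.symm h hr, hs⟩, hZ.projDimLE_two h hd⟩
  · rintro Z ⟨-, -, ⟨M', hM', hs⟩, hd⟩ M hM
    rw [isTrR_iff_isTranspose] at hM'
    obtain ⟨E⟩ := hM'.nonempty_equiv hM
    exact ⟨hM.finite h.symm, hM.reduced h.symm, fun i hi => (hs i hi).of_equiv E,
      hM.projective_dual h.symm hd⟩
  · rintro M ⟨-, hr, -, -⟩ Z hZ M' hM'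
    exact hM'.nonempty_equiv (hZ.symm h hr)
  · rintro Z ⟨-, hr, -, -⟩ M hM Z' hZ'
    exact hZ'.nonempty_equiv (hM.symm h.symm hr)
end

section
/- Let M be a left A-module. The following conditions are equivalent: (i) M is semi-Gorenstein-projective, the canonical map φ_M : M → M** is an epimorphism, and M* is projective; (ii) M is the direct sum of a projective module and a Nunke module. -/
/-!
Common background: `A` is an artin algebra (an algebra over a commutative artinian
ring `k`, finitely generated as `k`-module).  Left `A`-modules are `Module A M`;
right `A`-modules are `Module Aᵐᵒᵖ N`.  `Dl A M = Hom_A(M,A)` is the `A`-dual of a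
left module (a right module) and `Dr A N` the dual of a right module (a left module);
`evalL A M : M → M**` is the canonical evaluation map `φ_M`.
-/

open CategoryTheory LinearMap

universe u

theorem CategoryTheory.Functor.leftDerived_map_add {C D : Type*} [Category* C] [Category* D]
    [Abelian C] [HasProjectiveResolutions C] [Abelian D] (F : C ⥤ D) [F.Additive] (n : ℕ)
    {X Y : C} (f g : X ⟶ Y) :
    (F.leftDerived n).map (f + g) = (F.leftDerived n).map f + (F.leftDerived n).map g := by
  let P := projectiveResolution X
  let Q := projectiveResolution Y
  have hf := ProjectiveResolution.lift_commutes f P Q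
  have hg := ProjectiveResolution.lift_commutes g P Q
  rw [F.leftDerived_map_eq n f (ProjectiveResolution.lift f P Q) hf,
    F.leftDerived_map_eq n g (ProjectiveResolution.lift g P Q) hg,
    F.leftDerived_map_eq n (f + g)
      (ProjectiveResolution.lift f P Q + ProjectiveResolution.lift g P Q)
      (by rw [Preadditive.add_comp, hf, hg, ← Preadditive.comp_add, Functor.map_add])]
  rw [Functor.map_add, Preadditive.add_comp, Preadditive.comp_add]

/-- An additive derived functor vanishes on an object whose identity is a sum of two
endomorphisms, each of which factors through an object on which the functor vanishes. -/
theorem CategoryTheory.Functor.isZero_leftDerived_obj {C D : Type*} [Category* C] [Category* D]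
    [Abelian C] [HasProjectiveResolutions C] [Abelian D] (F : C ⥤ D) [F.Additive] (n : ℕ)
    {X X₁ X₂ : C} (a₁ : X ⟶ X₁) (b₁ : X₁ ⟶ X) (a₂ : X ⟶ X₂) (b₂ : X₂ ⟶ X)
    (h : a₁ ≫ b₁ + a₂ ≫ b₂ = 𝟙 X) (h₁ : Limits.IsZero ((F.leftDerived n).obj X₁))
    (h₂ : Limits.IsZero ((F.leftDerived n).obj X₂)) :
    Limits.IsZero ((F.leftDerived n).obj X) := by
  rw [Limits.IsZero.iff_id_eq_zero, ← Functor.map_id, ← h, F.leftDerived_map_add,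
    Functor.map_comp, Functor.map_comp, h₁.eq_of_tgt ((F.leftDerived n).map a₁) 0,
    h₂.eq_of_tgt ((F.leftDerived n).map a₂) 0, Limits.zero_comp, Limits.zero_comp, add_zero]

section

variable {A : Type u} [Ring A]
  {M : Type u} [AddCommGroup M] [Module A M]
  {M₁ : Type u} [AddCommGroup M₁] [Module A M₁] {M₂ : Type u} [AddCommGroup M₂] [Module A M₂]

theorem sGp.of_factors (a₁ : M →ₗ[A] M₁) (b₁ : M₁ →ₗ[A] M) (a₂ : M →ₗ[A] M₂) (b₂ : M₂ →ₗ[A] M)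
    (h : ∀ x, b₁ (a₁ x) + b₂ (a₂ x) = x) (h₁ : sGp A M₁) (h₂ : sGp A M₂) : sGp A M := by
  intro i hi
  refine (Functor.isZero_leftDerived_obj
    ((linearYoneda ℤ (ModuleCat.{u} A)).obj (ModuleCat.of A A)).rightOp i
    (ModuleCat.ofHom a₁) (ModuleCat.ofHom b₁) (ModuleCat.ofHom a₂) (ModuleCat.ofHom b₂) ?_
    (h₁ i hi).op (h₂ i hi).op).unop
  ext x
  exact h x

theorem sGp_of_projective [Module.Projective A M] : sGp A M := by
  intro i hi
  obtain ⟨j, rfl⟩ := Nat.exists_eq_add_of_le' hi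
  have := (IsProjective.iff_projective M).mp ‹Module.Projective A M›
  exact isZero_Ext_succ_of_projective _ _ j

instance : Module.Free Aᵐᵒᵖ A :=
  Module.Free.of_equiv
    ({ MulOpposite.opAddEquiv.symm with map_smul' := fun _ _ => rfl } : Aᵐᵒᵖ ≃ₗ[Aᵐᵒᵖ] A)

/-- A finite dual basis for the `A`-valued linear forms on `M`: `f = ∑ i, q i * f (x i)`. -/
def IsDualBasis {n : ℕ} (x : Fin n → M) (q : Fin n → M →ₗ[A] A) : Prop :=
  ∀ (f : M →ₗ[A] A) (m : M), f m = ∑ i, q i m * f (x i)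

theorem exists_repr_of_projective (R N : Type*) [Ring R] [AddCommGroup N] [Module R N]
    [Module.Finite R N] [Module.Projective R N] :
    ∃ (n : ℕ) (x : Fin n → N) (q : Fin n → N →ₗ[R] R), ∀ y, ∑ i, q i y • x i = y := by
  obtain ⟨n, f, g, -, -, h⟩ := Module.Finite.exists_comp_eq_id_of_projective R N
  refine ⟨n, fun i => f (Pi.single i 1), fun i => (LinearMap.proj i).comp g, fun y => ?_⟩
  conv_rhs => rw [← LinearMap.id_apply (R := R) y, ← h]
  rw [LinearMap.comp_apply, pi_apply_eq_sum_univ f (g y)]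
  refine Finset.sum_congr rfl fun i _ => ?_
  simp only [LinearMap.comp_apply, proj_apply]
  congr 2
  ext j
  simp [Pi.single_apply, eq_comm]

theorem IsDualBasis.projective_dual {n : ℕ} {x : Fin n → M} {q : Fin n → M →ₗ[A] A}
    (h : IsDualBasis x q) : Module.Projective Aᵐᵒᵖ (Dl A M) := by
  let i : Dl A M →ₗ[Aᵐᵒᵖ] (Fin n → A) :=
    { toFun := fun f j => f (x j)
      map_add' := fun _ _ => rfl
      map_smul' := fun _ _ => rfl }
  let s : (Fin n → A) →ₗ[Aᵐᵒᵖ] Dl A M :=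
    { toFun := fun a => ∑ j, MulOpposite.op (a j) • q j
      map_add' := fun a b => by simp [add_smul, Finset.sum_add_distrib]
      map_smul' := fun a b => by simp [Finset.smul_sum, mul_smul] }
  refine Module.Projective.of_split i s ?_
  ext f m
  simp [i, s, h f m]

theorem IsDualBasis.evalL_surjective {n : ℕ} {x : Fin n → M} {q : Fin n → M →ₗ[A] A}
    (h : IsDualBasis x q) : Function.Surjective (evalL A M) := by
  intro F
  refine ⟨∑ i, F (q i) • x i, ?_⟩
  ext f
  have hf : f = ∑ i, MulOpposite.op (f (x i)) • q i := by
    ext m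
    simp [h f m]
  have hF : F f = ∑ i, F (q i) * f (x i) := by
    conv_lhs => rw [hf]
    simp
  rw [hF]
  simp [evalL]

theorem projective_Dr (N : Type u) [AddCommGroup N] [Module Aᵐᵒᵖ N]
    [Module.Finite Aᵐᵒᵖ N] [Module.Projective Aᵐᵒᵖ N] : Module.Projective A (Dr A N) := by
  obtain ⟨n, x, q, h⟩ := exists_repr_of_projective Aᵐᵒᵖ N
  let i : Dr A N →ₗ[A] (Fin n → A) :=
    { toFun := fun f j => f (x j)
      map_add' := fun _ _ => rfl
      map_smul' := fun _ _ => rfl }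
  let e : Aᵐᵒᵖ →ₗ[Aᵐᵒᵖ] A :=
    { MulOpposite.opAddEquiv.symm with map_smul' := fun _ _ => rfl }
  let s : (Fin n → A) →ₗ[A] Dr A N :=
    { toFun := fun a => ∑ j, a j • e.comp (q j)
      map_add' := fun a b => by simp [add_smul, Finset.sum_add_distrib]
      map_smul' := fun a b => by simp [Finset.smul_sum, mul_smul] }
  refine Module.Projective.of_split i s ?_
  ext f y
  conv_rhs => rw [LinearMap.id_apply, ← h y]
  simp [i, s, e]

theorem finite_Dl [IsNoetherian Aᵐᵒᵖ A] [Module.Finite A M] : Module.Finite Aᵐᵒᵖ (Dl A M) := by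
  obtain ⟨n, x, hx⟩ := Module.Finite.exists_fin (R := A) (M := M)
  let i : Dl A M →ₗ[Aᵐᵒᵖ] (Fin n → A) :=
    { toFun := fun f j => f (x j)
      map_add' := fun _ _ => rfl
      map_smul' := fun _ _ => rfl }
  refine Module.Finite.of_injective i fun f g hfg => ?_
  refine LinearMap.ext_on_range hx fun j => ?_
  exact congrFun hfg j

end

/-- Proposition 3.4: `M` is semi-Gorenstein-projective with `φ_M` an epimorphism and `M^*`
projective iff `M` is the direct sum of a projective module and a Nunke module. -/
theorem sgp_phi_epi_dual_proj_iff_proj_plus_nunke (k : Type u) [CommRing k] [IsArtinianRing k]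
    (A : Type u) [Ring A] [Algebra k A] [Module.Finite k A]
    (M : Type u) [AddCommGroup M] [Module A M] [Module.Finite A M] :
    (sGp A M ∧ Function.Surjective (evalL A M) ∧ Module.Projective Aᵐᵒᵖ (Dl A M)) ↔
      (∃ N N' : Submodule A M, IsCompl N N' ∧ Module.Projective A (↥N) ∧ NunkeL A (↥N')) := by
  constructor
  · rintro ⟨hM, hsurj, hproj⟩
    have : IsNoetherian Aᵐᵒᵖ A := isNoetherian_of_tower k inferInstance
    have : Module.Finite Aᵐᵒᵖ (Dl A M) := finite_Dl
    have : Module.Projective A (Dr A (Dl A M)) := projective_Dr _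
    obtain ⟨s, hs⟩ := Module.projective_lifting_property (evalL A M) LinearMap.id hsurj
    have hs' (y) : evalL A M (s y) = y := LinearMap.congr_fun hs y
    have hinj : Function.Injective s := Function.LeftInverse.injective hs'
    let p : M →ₗ[A] ker (evalL A M) :=
      (LinearMap.id - s.comp (evalL A M)).codRestrict _ fun x => by simp [hs']
    have hp (x : ker (evalL A M)) : p x = x := by
      ext
      simp [p]
    have hker : ker p = range s := by
      ext x
      refine ⟨fun h => ⟨evalL A M x, ?_⟩, ?_⟩
      · exact (sub_eq_zero.mp (congrArg Subtype.val (show p x = 0 from h))).symm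
      · rintro ⟨y, rfl⟩
        refine Subtype.ext ?_
        simp [p, hs']
    refine ⟨range s, ker (evalL A M), hker ▸ (isCompl_of_proj hp).symm,
      Module.Projective.of_equiv (LinearEquiv.ofInjective s hinj),
      sGp.of_factors (ker (evalL A M)).subtype p 0 0 (fun x => by simp [hp]) hM hM, fun f => ?_⟩
    ext x
    have h : f (p x) = 0 := LinearMap.congr_fun (x.2 : evalL A M x = 0) (f.comp p)
    rwa [hp] at h
  · rintro ⟨N, N', hc, hN, hN', hz⟩
    let p := N.projectionOnto N' hc
    let p' := N'.projectionOnto N hc.symm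
    have hp (x : M) : (p x : M) + p' x = x :=
      Submodule.projection_add_projection_eq_self hc x
    have : Module.Finite A N :=
      Module.Finite.of_surjective p (Submodule.projectionOnto_surjective hc)
    obtain ⟨n, x, q, h⟩ := exists_repr_of_projective A N
    have hb : IsDualBasis (fun i => (x i : M)) (fun i => (q i).comp p) := by
      intro f m
      have h0 : f (p' m) = 0 := LinearMap.congr_fun (hz (f.comp N'.subtype)) (p' m)
      conv_lhs => rw [← hp m, map_add, h0, add_zero, ← h (p m)]
      simp
    exact ⟨sGp.of_factors p N.subtype p' N'.subtype hp sGp_of_projective hN',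
      hb.evalL_surjective, hb.projective_dual⟩
end

section
/- Let S be a simple injective left A-module, e a primitive idempotent of A with eS ≠ 0, and B = A/AeA. Then for all finitely generated B-modules U, U' (regarded also as A-modules via the quotient map A → B) and all i ≥ 0, there is an isomorphism Ext^i_A(U, U') ≅ Ext^i_B(U, U'). -/
/-!
Common background: `A` is an artin algebra (an algebra over a commutative artinian
ring `k`, finitely generated as `k`-module).  Left `A`-modules are `Module A M`;
right `A`-modules are `Module Aᵐᵒᵖ N`.  `Dl A M = Hom_A(M,A)` is the `A`-dual of a
left module (a right module) and `Dr A N` the dual of a right module (a left module);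
`evalL A M : M → M**` is the canonical evaluation map `φ_M`.
-/

open CategoryTheory LinearMap

universe u

/-- The factor algebra `B = A / AeA`, the quotient of `A` by the two-sided ideal
generated by the idempotent `e`. -/
abbrev Bquot (A : Type u) [Ring A] (e : A) : Type u := (TwoSidedIdeal.span {e}).ringCon.Quotient

/-- The quotient map `A → B = A/AeA`. -/
abbrev Bproj (A : Type u) [Ring A] (e : A) : A →+* Bquot A e := (TwoSidedIdeal.span {e}).ringCon.mk'

/-- `e` is a primitive idempotent of `A`. -/
def IsPrimIdem (A : Type u) [Ring A] (e : A) : Prop :=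
  IsIdempotentElem e ∧ e ≠ 0 ∧
    ∀ a b : A, IsIdempotentElem a → IsIdempotentElem b → a * b = 0 → b * a = 0 →
      e = a + b → a = 0 ∨ b = 0

theorem Module.Projective.of_ringHom_of_section {R T : Type*} [Ring R] [Ring T] (f : R →+* T)
    (σ : T →+ R) (hσ : ∀ r t, σ (f r * t) = r * σ t) (hf : ∀ t, f (σ t) = t)
    (P : Type*) [AddCommGroup P] [Module R P] [Module T P] (hP : ∀ (r : R) (p : P), r • p = f r • p)
    [Module.Projective T P] : Module.Projective R P := by
  obtain ⟨s, hs⟩ := Module.Projective.out (R := T) (P := P)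
  let g : P →ₗ[R] P →₀ R :=
    { toFun := fun p ↦ (s p).mapRange σ σ.map_zero
      map_add' := fun p q ↦ by ext; simp
      map_smul' := fun r p ↦ by ext; simp [hP, hσ] }
  refine ⟨⟨g, fun p ↦ ?_⟩⟩
  conv_rhs => rw [← hs p]
  simp [g, Finsupp.linearCombination_apply, Finsupp.sum_mapRange_index, hP, hf]

/-- A surjective ring homomorphism whose kernel has a right identity splits as a map of left
modules. -/
theorem RingHom.exists_section_of_ker_right_identity {R T : Type*} [Ring R] [Ring T] (f : R →+* T)
    (hf : Function.Surjective f) (x : R) (hx : f x = 0) (hker : ∀ y, f y = 0 → y * x = y) :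
    ∃ σ : T →+ R, (∀ r t, σ (f r * t) = r * σ t) ∧ ∀ t, f (σ t) = t := by
  have key : ∀ a b, f a = f b → a * (1 - x) = b * (1 - x) := fun a b h ↦ by
    have := hker (a - b) (by simp [h])
    rw [← sub_eq_zero, ← sub_mul, mul_sub, this]
    simp
  refine ⟨AddMonoidHom.mk' (fun t ↦ Function.surjInv hf t * (1 - x)) fun s t ↦ ?_,
    fun r t ↦ ?_, fun t ↦ ?_⟩
  · rw [← add_mul]
    exact key _ _ (by simp [Function.surjInv_eq])
  · simp only [AddMonoidHom.mk'_apply]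
    rw [← mul_assoc]
    exact key _ _ (by simp [Function.surjInv_eq])
  · simp [Function.surjInv_eq, hx]

/-- In an artinian ring, a primitive idempotent `e` generates a local left ideal: an element
of `Re` that does not annihilate a vector `e • s` of a simple module generates `Re`. -/
theorem IsPrimIdem.exists_mul_mul_eq {R : Type u} [Ring R] [IsArtinianRing R] {e : R}
    (he : IsPrimIdem R e) {S : Type*} [AddCommGroup S] [Module R S] [IsSimpleModule R S]
    {s : S} {a : R} (has : a • e • s ≠ 0) : ∃ c, c * (a * e) = e := by
  obtain ⟨hee, -, hprim⟩ := he
  have hs0 : e • s ≠ 0 := fun h ↦ has (by rw [h, smul_zero])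
  obtain ⟨b, hb⟩ := IsSimpleModule.toSpanSingleton_surjective R has (e • s)
  rw [LinearMap.toSpanSingleton_apply] at hb
  let Q : Set (Ideal R) := {L | ∃ z, z * e = z ∧ e * z = z ∧ (∃ d, z = d * (a * e)) ∧
    z • e • s = e • s ∧ L = Ideal.span {z}}
  have hQ : Q.Nonempty := ⟨_, e * b * a * e, by simp [mul_assoc, hee.eq],
    by simp [← mul_assoc, hee.eq], ⟨e * b, by simp [mul_assoc]⟩,
    by simp only [mul_smul, hb, ← mul_smul e e, hee.eq], rfl⟩
  obtain ⟨L, ⟨z, hze, hez, ⟨d, hd⟩, hzs, rfl⟩, hmin⟩ := WellFounded.has_min wellFounded_lt Q hQ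
  have hle : Ideal.span {z * z} ≤ Ideal.span {z} :=
    (Ideal.span_singleton_le_iff_mem _).2 (Ideal.mem_span_singleton'.2 ⟨z, rfl⟩)
  have hzz : z ∈ Ideal.span {z * z} := by
    have := hmin (Ideal.span {z * z}) ⟨z * z, by rw [mul_assoc, hze], by rw [← mul_assoc, hez],
      ⟨z * d, by rw [mul_assoc, ← hd]⟩, by rw [mul_smul, hzs, hzs], rfl⟩
    rw [(hle.eq_or_lt).resolve_right this]
    exact Ideal.mem_span_singleton_self z
  obtain ⟨c, hc⟩ := Ideal.mem_span_singleton'.1 hzz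
  let ρ : Ideal.span {z} →ₗ[R] Ideal.span {z} :=
    (LinearMap.toSpanSingleton R R z).restrict fun y _ ↦ Ideal.mem_span_singleton'.2 ⟨y, rfl⟩
  have hρ : Function.Surjective ρ := by
    rintro ⟨y, hy⟩
    obtain ⟨r, rfl⟩ := Ideal.mem_span_singleton'.1 hy
    refine ⟨⟨r * c * z, Ideal.mem_span_singleton'.2 ⟨r * c, rfl⟩⟩, Subtype.ext ?_⟩
    change r * c * z * z = r * z
    rw [mul_assoc, mul_assoc, hc]
  have hinj := IsNoetherian.injective_of_surjective_endomorphism ρ hρ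
  have hzcz : z * c * z = z := by
    have : ρ ⟨z * c * z, Ideal.mem_span_singleton'.2 ⟨z * c, rfl⟩⟩ =
        ρ ⟨z, Ideal.mem_span_singleton_self z⟩ := Subtype.ext <| by
      change z * c * z * z = z * z
      rw [mul_assoc, mul_assoc, hc]
    exact congrArg Subtype.val (hinj this)
  set p := e * c * z with hp
  have hep : e * p = p := by rw [hp, ← mul_assoc, ← mul_assoc, hee.eq]
  have hpe : p * e = p := by rw [hp, mul_assoc, hze]
  have hzp : z * p = z := by rw [hp, ← mul_assoc, ← mul_assoc, hze, hzcz]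
  have hpp : p * p = p := by
    nth_rewrite 1 [hp]
    rw [mul_assoc, hzp]
  rcases hprim p (e - p) hpp
    (by simp only [IsIdempotentElem, mul_sub, sub_mul, hee.eq, hep, hpe, hpp]; simp)
    (by rw [mul_sub, hpe, hpp, sub_self]) (by rw [sub_mul, hep, hpp, sub_self]) (by simp) with h | h
  · rw [h, mul_zero] at hzp
    exact absurd (by rw [← hzs, ← hzp, zero_smul]) hs0
  · exact ⟨e * c * d, by rw [mul_assoc, ← hd, ← hp, ← sub_eq_zero.1 h]⟩

theorem IsPrimIdem.mul_eq_zero_of_mem_jacobson {R : Type u} [Ring R] [IsArtinianRing R] {e : R}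
    (he : IsPrimIdem R e) {S : Type u} [AddCommGroup S] [Module R S] [IsSimpleModule R S]
    [Module.Injective R S] (hS : ∃ s : S, e • s ≠ 0) {j : R} (hj : j ∈ Ring.jacobson R) :
    e * j = 0 := by
  by_contra hne
  obtain ⟨s, hs⟩ := hS
  have hker : ker (LinearMap.toSpanSingleton R R (e * j)) ≤
      ker (LinearMap.toSpanSingleton R S (e • s)) := fun a ha ↦ by
    by_contra h
    obtain ⟨c, hc⟩ := he.exists_mul_mul_eq (s := s) (a := a) h
    have ha : a * (e * j) = 0 := ha
    exact hne (by rw [← hc, mul_assoc, mul_assoc, ha, mul_zero])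
  let i := (ker (LinearMap.toSpanSingleton R R (e * j))).liftQ _ le_rfl
  have hi : Function.Injective i := LinearMap.ker_eq_bot.1 (Submodule.ker_liftQ_eq_bot' _ _ rfl)
  obtain ⟨h, hh⟩ := Module.Injective.out i hi ((ker _).liftQ _ hker)
  have h1 : h (e * j) = e • s := by simpa [i] using hh (Submodule.Quotient.mk 1)
  apply hs
  rw [← h1, ← mul_one (e * j), ← smul_eq_mul, map_smul, mul_smul,
    Module.mem_annihilator.1 (IsSemisimpleModule.jacobson_le_annihilator R S hj), smul_zero]

theorem TwoSidedIdeal.exists_right_identity_of_mul_jacobson {R : Type*} [Ring R]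
    [IsSemiprimaryRing R] {e : R} (he : ∀ j ∈ Ring.jacobson R, e * j = 0)
    (hee : IsIdempotentElem e) :
    ∃ x ∈ TwoSidedIdeal.span {e}, ∀ y ∈ TwoSidedIdeal.span {e}, y * x = y := by
  let I := TwoSidedIdeal.span {e}
  let q := Ideal.Quotient.mk (Ring.jacobson R)
  have hq : Function.Surjective q := Ideal.Quotient.mk_surjective
  obtain ⟨C, hC⟩ := exists_isCompl (I.asIdeal.map q)
  obtain ⟨u, hu, v, hv, huv⟩ := Submodule.mem_sup.1
    (hC.sup_eq_top ▸ Submodule.mem_top : (1 : R ⧸ Ring.jacobson R) ∈ I.asIdeal.map q ⊔ C)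
  obtain ⟨x, hx, rfl⟩ := (Ideal.mem_map_iff_of_surjective q hq).1 hu
  refine ⟨x, hx, fun y hy ↦ ?_⟩
  have hmem : ∀ y ∈ I, y * x - y ∈ Ring.jacobson R := fun y hy ↦ by
    have hqy : q y ∈ I.asIdeal.map q := Ideal.mem_map_of_mem q hy
    have hsplit : q y - q y * q x = q y * v := by rw [sub_eq_iff_eq_add', ← mul_add, huv, mul_one]
    have h0 : q y * v = 0 := by
      refine Submodule.disjoint_def.1 hC.disjoint _ ?_ (C.smul_mem _ hv)
      rw [← hsplit]
      exact Submodule.sub_mem _ hqy (Ideal.mul_mem_left _ _ hu)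
    rw [← Ideal.Quotient.eq, map_mul]
    exact (sub_eq_zero.1 (hsplit.trans h0)).symm
  rw [TwoSidedIdeal.mem_span_iff_mem_addSubgroup_closure] at hy
  induction hy using AddSubgroup.closure_induction with
  | mem y hy =>
    obtain ⟨_, ⟨a, -, c, hc, rfl⟩, b, -, rfl⟩ := hy
    obtain rfl : c = e := hc
    change a * c * b * x = a * c * b
    have h := he _ (hmem (c * b) (TwoSidedIdeal.mul_mem_right _ _ _
      (TwoSidedIdeal.subset_span rfl)))
    rw [mul_sub, ← mul_assoc, ← mul_assoc, hee.eq, sub_eq_zero] at h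
    simp only [mul_assoc] at h ⊢
    rw [h]
  | zero => simp
  | add y z _ _ hy hz => rw [add_mul, hy, hz]
  | neg y _ hy => rw [neg_mul, hy]

section ExtOfFullyFaithful

variable {C D : Type*} [Category.{u} C] [Category.{u} D] [Abelian C] [Abelian D]
  (F : C ⥤ D) [F.Additive] [F.Full] [F.Faithful]

/-- A full and faithful additive functor is bijective on groups of morphisms. -/
noncomputable def CategoryTheory.Functor.homLinearEquivInt (X Y : C) :
    (X ⟶ Y) ≃ₗ[ℤ] (F.obj X ⟶ F.obj Y) :=
  AddEquiv.toIntLinearEquiv { (Functor.FullyFaithful.ofFullyFaithful F).homEquiv with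
    map_add' := fun _ _ ↦ F.map_add }

/-- A full and faithful additive functor commutes with forming Hom complexes. -/
noncomputable def CategoryTheory.Functor.linearYonedaObjMapIso [EnoughProjectives C]
    [EnoughProjectives D] (K : ChainComplex C ℕ) (Y : C) :
    K.linearYonedaObj ℤ Y ≅
      ChainComplex.linearYonedaObj ((F.mapHomologicalComplex _).obj K) ℤ (F.obj Y) :=
  HomologicalComplex.Hom.isoOfComponents
    (fun i ↦ (F.homLinearEquivInt (K.X i) Y).toModuleIso) fun i j _ ↦
      ModuleCat.hom_ext <| LinearMap.ext fun f ↦ (F.map_comp (K.d j i) f).symm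

/-- A full and faithful exact functor preserving projective objects preserves `Ext`. -/
noncomputable def CategoryTheory.Functor.extIso [EnoughProjectives C] [EnoughProjectives D]
    [F.PreservesProjectiveObjects] [F.PreservesHomology] (X Y : C) (n : ℕ) :
    ((Ext ℤ D n).obj (Opposite.op (F.obj X))).obj (F.obj Y) ≅
      ((Ext ℤ C n).obj (Opposite.op X)).obj Y :=
  let P := projectiveResolution X
  (F.mapProjectiveResolution P).isoExt n (F.obj Y) ≪≫
    (HomologicalComplex.homologyFunctor _ _ n).mapIso (F.linearYonedaObjMapIso P.complex Y).symm ≪≫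
    (P.isoExt n Y).symm

end ExtOfFullyFaithful

/-- 3.6(b): for `B`-modules `U, U'` (regarded as `A`-modules through `A → B = A/AeA`),
`Ext^i_A(U, U') ≅ Ext^i_B(U, U')` for all `i ≥ 0`. -/
theorem ext_iso_of_quotient_algebra (k : Type u) [CommRing k] [IsArtinianRing k]
    (A : Type u) [Ring A] [Algebra k A] [Module.Finite k A]
    (e₀ : A) (he₀ : IsPrimIdem A e₀)
    (S : Type u) [AddCommGroup S] [Module A S] [Module.Finite A S]
    (hsimple : IsSimpleModule A S) (hinjective : Module.Injective A S)
    (heS : ∃ s : S, e₀ • s ≠ 0)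
    (U U' : ModuleCat.{u} (Bquot A e₀))
    (hU : Module.Finite (Bquot A e₀) (↥U)) (hU' : Module.Finite (Bquot A e₀) (↥U'))
    (i : ℕ) :
    Nonempty ((((Ext ℤ (ModuleCat.{u} A) i).obj
        (Opposite.op ((ModuleCat.restrictScalars (Bproj A e₀)).obj U))).obj
        ((ModuleCat.restrictScalars (Bproj A e₀)).obj U')) ≅
      (((Ext ℤ (ModuleCat.{u} (Bquot A e₀)) i).obj (Opposite.op U)).obj U')) := by
  have : IsArtinianRing A := IsArtinianRing.of_finite k A
  have hproj : Function.Surjective (Bproj A e₀) := RingCon.mk'_surjective _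
  have hker (y : A) : Bproj A e₀ y = 0 ↔ y ∈ TwoSidedIdeal.span {e₀} := by
    rw [← TwoSidedIdeal.mem_ker, TwoSidedIdeal.ker_ringCon_mk']
  obtain ⟨x, hx, hright⟩ := TwoSidedIdeal.exists_right_identity_of_mul_jacobson
    (fun _ ↦ he₀.mul_eq_zero_of_mem_jacobson heS) he₀.1
  obtain ⟨σ, hσ, hσf⟩ := (Bproj A e₀).exists_section_of_ker_right_identity hproj x
    ((hker x).2 hx) fun y hy ↦ hright y ((hker y).1 hy)
  let F := ModuleCat.restrictScalars.{u} (Bproj A e₀)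
  have : F.Full := ⟨fun f ↦ ⟨ModuleCat.ofHom
    { toFun := f.hom
      map_add' := map_add f.hom
      map_smul' := fun b m ↦ by
        obtain ⟨a, rfl⟩ := hproj b
        exact f.hom.map_smul a m }, rfl⟩⟩
  have : F.PreservesProjectiveObjects := ⟨fun {P} hP ↦ by
    have : Module.Projective A (F.obj P) :=
      let _ : Module (Bquot A e₀) (F.obj P) := inferInstanceAs (Module (Bquot A e₀) P)
      have : Module.Projective (Bquot A e₀) (F.obj P) := P.projective_of_module_projective
      Module.Projective.of_ringHom_of_section (T := Bquot A e₀) (Bproj A e₀) σ hσ hσf (F.obj P)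
        fun _ _ ↦ rfl
    exact ModuleCat.projective_of_categoryTheory_projective _⟩
  have : Limits.PreservesFiniteLimits F := ⟨fun _ ↦ ⟨inferInstance⟩⟩
  have : Limits.PreservesFiniteColimits F := ⟨fun _ ↦ ⟨inferInstance⟩⟩
  exact ⟨F.extIso U U' i⟩
end

section
/- Let S be a simple injective left A-module, e a primitive idempotent of A with eS ≠ 0, B = A/AeA, P(S) the projective cover of S, and M = Ω S = rad P(S). Then for every finitely generated B-module U and all i ≥ 0, there are isomorphisms Ext^i_A(U, P(S)) ≅ Ext^i_A(U, M) ≅ Ext^i_B(U, M). -/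
/-!
Common background: `A` is an artin algebra (an algebra over a commutative artinian
ring `k`, finitely generated as `k`-module).  Left `A`-modules are `Module A M`;
right `A`-modules are `Module Aᵐᵒᵖ N`.  `Dl A M = Hom_A(M,A)` is the `A`-dual of a
left module (a right module) and `Dr A N` the dual of a right module (a left module);
`evalL A M : M → M**` is the canonical evaluation map `φ_M`.
-/

open CategoryTheory LinearMap

universe u

namespace TwoSidedIdeal

/-- If every nonzero element of `eA` has a right inverse relative to `e`, then the ideal `AeA`
of a left noetherian ring is generated, as a left ideal, by an idempotent. -/
theorem exists_mem_span_singleton_mul_eq {A : Type*} [Ring A] [IsNoetherianRing A] {e : A}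
    (he : ∀ y : A, e * y = y → y ≠ 0 → ∃ w, y * w = e) (hee : e * e = e) :
    ∃ f ∈ span {e}, ∀ x ∈ span {e}, x * f = x := by
  obtain ⟨_, ⟨f, ⟨hfI, hff⟩, rfl⟩, hmax⟩ := set_has_maximal_iff_noetherian.mpr ‹IsNoetherianRing A›
    ((fun f : A => Ideal.span {f}) '' {f | f ∈ span {e} ∧ f * f = f})
    ⟨_, 0, ⟨zero_mem _, by simp⟩, rfl⟩
  have heI : e ∈ span {e} := subset_span rfl
  have key (b : A) : e * b * f = e * b := by
    by_contra hne
    set y := e * b - e * b * f with hy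
    have hy0 : y ≠ 0 := sub_ne_zero.mpr (Ne.symm hne)
    have hey : e * y = y := by simp only [hy, mul_sub, ← mul_assoc, hee]
    have hyf : y * f = 0 := by simp only [hy, sub_mul, mul_assoc, hff, sub_self]
    obtain ⟨w, hw⟩ := he y hey hy0
    have hyI : y ∈ span {e} := hey ▸ mul_mem_right _ _ _ heI
    set g := (w - f * w) * y with hg
    have hyw : y * (w - f * w) = e := by rw [mul_sub, ← mul_assoc, hyf, zero_mul, sub_zero, hw]
    have hgf : g * f = 0 := by rw [hg, mul_assoc, hyf, mul_zero]
    have hfg : f * g = 0 := by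
      have : f * (w - f * w) = 0 := by rw [mul_sub, ← mul_assoc, hff, sub_self]
      rw [hg, ← mul_assoc, this, zero_mul]
    have hyg : y * g = y := by rw [hg, ← mul_assoc, hyw, hey]
    have hgg : g * g = g := by
      nth_rw 1 [hg]
      rw [mul_assoc, hyg]
    refine hmax _ ⟨f + g, ⟨add_mem _ hfI (mul_mem_left _ _ _ hyI), ?_⟩, rfl⟩
      (lt_of_le_of_ne ?_ fun heq => ?_)
    · rw [mul_add, add_mul, add_mul, hff, hgf, hfg, hgg, add_zero, zero_add]
    · rw [Ideal.span_singleton_le_iff_mem, Ideal.mem_span_singleton']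
      exact ⟨f, by rw [mul_add, hff, hfg, add_zero]⟩
    · have hmem : f + g ∈ Ideal.span {f} := by
        rw [show Ideal.span {f} = Ideal.span {f + g} from heq]
        exact Ideal.mem_span_singleton_self _
      obtain ⟨c, hc⟩ := Ideal.mem_span_singleton'.mp hmem
      have hg0 : g = 0 := by
        have h : (f + g) * f = f + g := by rw [← hc, mul_assoc, hff]
        rwa [add_mul, hff, hgf, add_zero, left_eq_add] at h
      exact hy0 (by rw [← hyg, hg0, mul_zero])
  refine ⟨f, hfI, fun x hx => ?_⟩
  have hxb : ∀ b, x * b * f = x * b := by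
    induction hx using span_induction with
    | mem x hx => obtain rfl := hx; exact key
    | zero => simp
    | add x y _ _ hx hy => intro b; simp only [add_mul, hx, hy]
    | neg x _ hx => intro b; simp only [neg_mul, hx]
    | left_absorb a x _ hx => intro b; simp only [mul_assoc] at hx ⊢; rw [hx]
    | right_absorb a x _ hx => intro b; rw [mul_assoc x, hx]
  simpa using hxb 1

end TwoSidedIdeal

section ProjectiveCover

variable {A : Type u} [Ring A] {S PS : Type u} [AddCommGroup S] [Module A S]
  [AddCommGroup PS] [Module A PS]

theorem IsProjCover.ker_eq_radM [IsSimpleModule A S] {π : PS →ₗ[A] S} (hπ : IsProjCover A π) :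
    ker π = radM A PS :=
  le_antisymm hπ.2.2.2 (sInf_le (isCoatom_ker_of_surjective hπ.2.2.1))

theorem IsProjCover.eq_top_of_not_le_ker [IsSimpleModule A S] {π : PS →ₗ[A] S}
    (hπ : IsProjCover A π) {N : Submodule A PS} (hN : ¬ N ≤ ker π) : N = ⊤ := by
  have := hπ.2.1
  by_contra hne
  obtain ⟨K, hK, hNK⟩ := (eq_top_or_exists_le_coatom N).resolve_left hne
  have hker : ker π ≤ K := hπ.2.2.2.trans (sInf_le hK)
  have : IsCoatom (ker π) := isCoatom_ker_of_surjective hπ.2.2.1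
  exact hN (hNK.trans_eq ((this.le_iff.mp hker).resolve_left hK.1))

/-- If `e` is primitive and acts nontrivially on `S`, the projective cover of `S` is `Ae`. -/
theorem IsProjCover.exists_generator [IsSimpleModule A S] {π : PS →ₗ[A] S}
    (hπ : IsProjCover A π) {e : A} (he : IsPrimIdem A e) (heS : ∃ s : S, e • s ≠ 0) :
    ∃ p : PS, e • p = p ∧ π p ≠ 0 ∧ (∀ q : PS, ∃ a : A, a • p = q) ∧
      ∀ x : A, x * e = x → x • p = 0 → x = 0 := by
  obtain ⟨s, hs⟩ := heS
  obtain ⟨p', rfl⟩ := hπ.2.2.1 s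
  have hep : e • e • p' = e • p' := by rw [smul_smul, he.1]
  rw [← map_smul] at hs
  generalize e • p' = p at hep hs
  have := hπ.1
  have hsurj : Function.Surjective (toSpanSingleton A PS p) := by
    rw [← range_eq_top]
    exact hπ.eq_top_of_not_le_ker fun h => hs (h ⟨1, by simp⟩)
  refine ⟨p, hep, hs, hsurj, fun x hxe hxp => ?_⟩
  obtain ⟨σ, hσ⟩ := Module.projective_lifting_property (toSpanSingleton A PS p) LinearMap.id hsurj
  have hap : σ p • p = p := by simpa using LinearMap.congr_fun hσ p
  have haa : σ p * σ p = σ p := by rw [← smul_eq_mul, ← map_smul, hap]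
  have hea : e * σ p = σ p := by rw [← smul_eq_mul, ← map_smul, hep]
  generalize ha : σ p = a at *
  have hee : e * e = e := he.1
  have h₁ : a * e * (a * e) = a * e := by rw [mul_assoc, ← mul_assoc e, hea, ← mul_assoc, haa]
  have h₂ : a * e * e = a * e := by rw [mul_assoc, hee]
  have h₃ : e * (a * e) = a * e := by rw [← mul_assoc, hea]
  rcases he.2.2 (a * e) (e - a * e) h₁ (by simp [IsIdempotentElem, mul_sub, sub_mul, h₁, h₂, h₃, hee])
    (by rw [mul_sub, h₁, h₂, sub_self]) (by rw [sub_mul, h₁, h₃, sub_self]) (by abel) with h | h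
  · refine absurd ?_ hs
    rw [← hap, ← hep, smul_smul, h, zero_smul, map_zero]
  · rw [← hxe, sub_eq_zero.mp h, ← ha, ← mul_assoc, ← smul_eq_mul x, ← map_smul, hxp, map_zero,
      zero_mul]

theorem IsProjCover.exists_mul_eq [IsSimpleModule A S] [Module.Injective A S] {π : PS →ₗ[A] S}
    (hπ : IsProjCover A π) {e : A} (he : IsPrimIdem A e) (heS : ∃ s : S, e • s ≠ 0)
    (hrad : ∀ q ∈ radM A PS, e • q = 0) {y : A} (hey : e * y = y) (hy : y ≠ 0) :
    ∃ w, y * w = e := by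
  obtain ⟨p, hep, hp, hgen, hinj⟩ := hπ.exists_generator he heS
  have hker : ker (toSpanSingleton A A y) ≤ ker (toSpanSingleton A S (π p)) := by
    intro a ha
    simp only [mem_ker, toSpanSingleton_apply, smul_eq_mul] at ha ⊢
    by_contra has
    have htop : (ker (toSpanSingleton A A y)).map (toSpanSingleton A PS p) = ⊤ :=
      hπ.eq_top_of_not_le_ker fun h => has <| by
        simpa using h (Submodule.mem_map_of_mem (r := a) (by simpa using ha))
    obtain ⟨x, hx, hxp⟩ : p ∈ (ker (toSpanSingleton A A y)).map (toSpanSingleton A PS p) :=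
      htop ▸ Submodule.mem_top
    simp only [SetLike.mem_coe, mem_ker, toSpanSingleton_apply, smul_eq_mul] at hx hxp
    have h := hinj (e - x * e) (by rw [sub_mul, mul_assoc, he.1]) (by
      rw [sub_smul, mul_smul, hep, hxp, sub_self])
    rw [← hey, sub_eq_zero.mp h, mul_assoc, hey] at hy
    exact hy hx
  obtain ⟨g, hg⟩ := Module.Injective.out (R := A) (Q := S)
    ((ker (toSpanSingleton A A y)).liftQ (toSpanSingleton A A y) le_rfl)
    (ker_eq_bot.mp (Submodule.ker_liftQ_eq_bot _ _ _ le_rfl))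
    ((ker (toSpanSingleton A A y)).liftQ (toSpanSingleton A S (π p)) hker)
  have hgy : y • g 1 = π p := by
    simpa [← map_smul] using hg (Submodule.Quotient.mk 1)
  obtain ⟨q, hq⟩ := hπ.2.2.1 (g 1)
  obtain ⟨w, rfl⟩ := hgen q
  have hmem : p - y • w • p ∈ radM A PS := by
    rw [← hπ.ker_eq_radM, mem_ker, map_sub, map_smul, hq, hgy, sub_self]
  have h := hrad _ hmem
  rw [smul_sub, hep, smul_smul, hey, smul_smul, sub_eq_zero] at h
  refine ⟨w * e, (sub_eq_zero.mp (hinj (e - y * (w * e)) ?_ ?_)).symm⟩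
  · simp only [sub_mul, mul_assoc, show e * e = e from he.1]
  · rw [sub_smul, ← mul_assoc, mul_smul _ e, hep, ← h, sub_self]

end ProjectiveCover

namespace ModuleCat

/-- If `S` is projective over `R`, restriction of scalars from `S` to `R` preserves
projective modules. -/
theorem restrictScalars_preservesProjectiveObjects {R S : Type u} [Ring R] [Ring S] (f : R →+* S)
    [Module.Projective R ((restrictScalars f).obj (of S S))] :
    (restrictScalars.{u} f).PreservesProjectiveObjects :=
  have : (coextendScalars.{u, u, u} f).PreservesEpimorphisms :=
    { preserves := fun {X Y} g hg => by
        rw [epi_iff_surjective] at hg ⊢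
        intro h
        obtain ⟨l, hl⟩ := Module.projective_lifting_property g.hom
          (CoextendScalars.equiv f Y h) hg
        exact ⟨(CoextendScalars.equiv f X).symm l, CoextendScalars.ext hl⟩ }
  Functor.preservesProjectiveObjects_of_adjunction_of_preservesEpimorphisms
    (restrictCoextendScalarsAdj.{u, u, u} f)

theorem restrictScalars_preservesHomology {R S : Type u} [Ring R] [Ring S] (f : R →+* S) :
    (restrictScalars.{u} f).PreservesHomology :=
  ((restrictScalars.{u} f).exact_tfae.out 1 2).mp fun T hT => by
    rw [ShortComplex.ShortExact.moduleCat_exact_iff_function_exact] at hT ⊢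
    exact hT

theorem restrictScalars_full {R S : Type u} [Ring R] [Ring S] {f : R →+* S}
    (hf : Function.Surjective f) : (restrictScalars.{u} f).Full where
  map_surjective {X Y} g :=
    ⟨ofHom (X := X) (Y := Y)
      { toFun := g.hom
        map_add' := g.hom.map_add
        map_smul' := fun s x => by
          obtain ⟨r, rfl⟩ := hf s
          exact g.hom.map_smul r x }, rfl⟩

end ModuleCat

section ExtComparison

universe v

variable {R : Type*} [Ring R] {C D : Type*} [Category.{v} C] [Abelian C] [CategoryTheory.Linear R C]
  [EnoughProjectives C] [Category.{v} D] [Abelian D]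
  [CategoryTheory.Linear R D] [EnoughProjectives D]

/-- A morphism inducing bijections on morphisms from the terms of a projective resolution of `X`
induces isomorphisms on `Ext` out of `X`. -/
theorem CategoryTheory.ProjectiveResolution.nonempty_ext_iso_of_bijective {X Y Y' : C}
    (P : ProjectiveResolution X) (g : Y ⟶ Y')
    (hg : ∀ n, Function.Bijective fun h : P.complex.X n ⟶ Y => h ≫ g) (i : ℕ) :
    Nonempty (((Ext R C i).obj (Opposite.op X)).obj Y ≅
      ((Ext R C i).obj (Opposite.op X)).obj Y') :=
  ⟨P.isoExt i Y ≪≫ (HomologicalComplex.homologyFunctor _ _ i).mapIso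
    (HomologicalComplex.Hom.isoOfComponents
      (C₁ := P.complex.linearYonedaObj R Y) (C₂ := P.complex.linearYonedaObj R Y')
      (fun n => (LinearEquiv.ofBijective (Linear.rightComp R (P.complex.X n) g) (hg n)).toModuleIso)
      fun m n _ => by ext h; exact (Category.assoc _ _ _).symm) ≪≫ (P.isoExt i Y').symm⟩

/-- A fully faithful exact functor preserving projective objects preserves `Ext`. -/
theorem CategoryTheory.Functor.nonempty_ext_iso (F : C ⥤ D) [F.Additive] [F.Linear R] [F.Full]
    [F.Faithful] [F.PreservesProjectiveObjects] [F.PreservesHomology] (X Y : C) (i : ℕ) :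
    Nonempty (((Ext R D i).obj (Opposite.op (F.obj X))).obj (F.obj Y) ≅
      ((Ext R C i).obj (Opposite.op X)).obj Y) := by
  let P := projectiveResolution X
  exact ⟨(F.mapProjectiveResolution P).isoExt i (F.obj Y) ≪≫
    (HomologicalComplex.homologyFunctor _ _ i).mapIso
    (HomologicalComplex.Hom.isoOfComponents
      (C₁ := P.complex.linearYonedaObj R Y)
      (C₂ := (F.mapProjectiveResolution P).complex.linearYonedaObj R (F.obj Y))
      (fun n => (LinearEquiv.ofBijective (F.mapLinearMap R (X := P.complex.X n) (Y := Y))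
        ⟨F.map_injective, F.map_surjective⟩).toModuleIso)
      fun m n _ => by ext h; exact (F.map_comp _ _).symm).symm ≪≫ (P.isoExt i Y).symm⟩

end ExtComparison

section Quotient

variable {A : Type u} [Ring A] {e : A}

theorem Bproj_eq_zero_iff {x : A} : Bproj A e x = 0 ↔ x ∈ TwoSidedIdeal.span {e} :=
  RingCon.eq _

theorem smul_restrictScalars_Bproj (U : ModuleCat.{u} (Bquot A e))
    (x : (ModuleCat.restrictScalars (Bproj A e)).obj U) : e • x = 0 := by
  rw [ModuleCat.restrictScalars.smul_def, Bproj_eq_zero_iff.mpr (TwoSidedIdeal.subset_span rfl), zero_smul]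
  rfl

theorem Bquot_projective {f : A} (hf : f ∈ TwoSidedIdeal.span {e})
    (h : ∀ x ∈ TwoSidedIdeal.span {e}, x * f = x) :
    Module.Projective A ((ModuleCat.restrictScalars (Bproj A e)).obj
      (ModuleCat.of (Bquot A e) (Bquot A e))) := by
  set B := (ModuleCat.restrictScalars (Bproj A e)).obj (ModuleCat.of (Bquot A e) (Bquot A e))
  let π : A →ₗ[A] B :=
    { toFun := Bproj A e
      map_add' := map_add _
      map_smul' := map_mul (Bproj A e) }
  have hπ : Function.Surjective π := RingCon.mk'_surjective _
  have hker : ker π ≤ ker (toSpanSingleton A A (1 - f)) := fun x hx => by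
    have hx' : x ∈ TwoSidedIdeal.span {e} := Bproj_eq_zero_iff.mp hx
    simp [mul_sub, h x hx']
  refine Module.Projective.of_split
    ((ker π).liftQ _ hker ∘ₗ (π.quotKerEquivOfSurjective hπ).symm.toLinearMap) π ?_
  rw [← cancel_right hπ]
  ext
  have h1 : (π.quotKerEquivOfSurjective hπ).symm (π 1) = Submodule.Quotient.mk 1 := by
    rw [LinearEquiv.symm_apply_eq]
    rfl
  have hf0 : π f = 0 := Bproj_eq_zero_iff.mpr hf
  simp [h1, hf0]

end Quotient

/-- 3.6(c): with `P(S)` the projective cover of `S` and `M = Ω S = rad P(S)` (a `B`-module),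
`Ext^i_A(U, P(S)) ≅ Ext^i_A(U, M) ≅ Ext^i_B(U, M)` for every `B`-module `U` and all `i ≥ 0`. -/
theorem ext_iso_cover_radical (k : Type u) [CommRing k] [IsArtinianRing k]
    (A : Type u) [Ring A] [Algebra k A] [Module.Finite k A]
    (e₀ : A) (he₀ : IsPrimIdem A e₀)
    (S : Type u) [AddCommGroup S] [Module A S] [Module.Finite A S]
    (hsimple : IsSimpleModule A S) (hinjective : Module.Injective A S)
    (heS : ∃ s : S, e₀ • s ≠ 0)
    (PS : Type u) [AddCommGroup PS] [Module A PS]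
    (eP : PS →ₗ[A] S) (hcov : IsProjCover A eP)
    (M' : ModuleCat.{u} (Bquot A e₀))
    (hM' : Nonempty ((↥((ModuleCat.restrictScalars (Bproj A e₀)).obj M')) ≃ₗ[A]
      ↥(radM A PS)))
    (U : ModuleCat.{u} (Bquot A e₀)) (hU : Module.Finite (Bquot A e₀) (↥U)) (i : ℕ) :
    Nonempty ((((Ext ℤ (ModuleCat.{u} A) i).obj
        (Opposite.op ((ModuleCat.restrictScalars (Bproj A e₀)).obj U))).obj
        (ModuleCat.of A PS)) ≅
      (((Ext ℤ (ModuleCat.{u} A) i).obj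
        (Opposite.op ((ModuleCat.restrictScalars (Bproj A e₀)).obj U))).obj
        (ModuleCat.of A (↥(radM A PS))))) ∧
    Nonempty ((((Ext ℤ (ModuleCat.{u} A) i).obj
        (Opposite.op ((ModuleCat.restrictScalars (Bproj A e₀)).obj U))).obj
        (ModuleCat.of A (↥(radM A PS)))) ≅
      (((Ext ℤ (ModuleCat.{u} (Bquot A e₀)) i).obj (Opposite.op U)).obj M')) := by
  have : IsNoetherianRing A := isNoetherian_of_tower k inferInstance
  have hrad : ∀ q ∈ radM A PS, e₀ • q = 0 := by
    obtain ⟨E⟩ := hM'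
    intro q hq
    have h := congrArg E (smul_restrictScalars_Bproj M' (E.symm ⟨q, hq⟩))
    rw [map_smul, E.apply_symm_apply, map_zero] at h
    exact congrArg Subtype.val h
  obtain ⟨f, hf, hfI⟩ := TwoSidedIdeal.exists_mem_span_singleton_mul_eq
    (fun y hey hy => hcov.exists_mul_eq he₀ heS hrad hey hy) he₀.1
  let F := ModuleCat.restrictScalars.{u} (Bproj A e₀)
  have := Bquot_projective hf hfI
  have : F.PreservesProjectiveObjects := ModuleCat.restrictScalars_preservesProjectiveObjects _
  have : F.Full := ModuleCat.restrictScalars_full (RingCon.mk'_surjective _)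
  have : F.PreservesHomology := ModuleCat.restrictScalars_preservesHomology _
  constructor
  · refine Nonempty.map Iso.symm ?_
    refine (F.mapProjectiveResolution (projectiveResolution U)).nonempty_ext_iso_of_bijective
      (ModuleCat.ofHom (radM A PS).subtype) (fun n => ⟨fun h₁ h₂ h => ?_, fun h => ?_⟩) i
    · ext x
      exact ConcreteCategory.congr_hom h x
    · have hS : eP.comp h.hom = 0 := by
        ext x
        by_contra hx
        obtain ⟨s, hs⟩ := heS
        obtain ⟨a, ha⟩ := IsSimpleModule.toSpanSingleton_surjective A hx s
        refine hs ?_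
        rw [← ha]
        have : e₀ • a • x = 0 := smul_restrictScalars_Bproj _ _
        simpa using congrArg (eP.comp h.hom) this
      have hmem (x) : h.hom x ∈ radM A PS := hcov.ker_eq_radM ▸ LinearMap.congr_fun hS x
      exact ⟨ModuleCat.ofHom (X := F.obj ((projectiveResolution U).complex.X n))
        (h.hom.codRestrict _ hmem), rfl⟩
  · obtain ⟨E⟩ := hM'
    obtain ⟨α⟩ := F.nonempty_ext_iso (R := ℤ) U M' i
    exact ⟨((Ext ℤ (ModuleCat.{u} A) i).obj _).mapIso
      (E.symm.toModuleIso : ModuleCat.of A (radM A PS) ≅ F.obj M') ≪≫ α⟩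
end
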